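/- Let n, m, k be natural numbers with n ≤ m and n ≤ k, let E ⊂ ℝ^k be an n-rectifiable set, and let D be any set with E ⊂ D ⊂ ℝ^k (for example D = ℝ^k). Then the set of functions f ∈ Lip_1(D, ℝ^m) satisfying ∫_{ℝ^m} #(E ∩ f⁻¹(y)) dH^n(y) = H^n(E) — where #(E ∩ f⁻¹(y)) is the (extended-natural-number) cardinality of the fibre of f over y intersected with E — is residual in Lip_1(D, ℝ^m). -/

import Mathlib

open MeasureTheory Metric Set Filter Topology ENNReal

noncomputable section

abbrev Euc (n : ℕ) : Type := EuclideanSpace ℝ (Fin n)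

/-- An `n`-rectifiable subset of a metric space: an `H^n`-measurable set which is, up to an
`H^n`-null set, covered by countably many Lipschitz images of subsets of `ℝ^n`. -/
def IsRectifiable (n : ℕ) {X : Type*} [MetricSpace X] [MeasurableSpace X] [BorelSpace X]
    (E : Set X) : Prop :=
  NullMeasurableSet E μH[n] ∧
    ∃ (F : ℕ → Set (Euc n)) (f : ℕ → Euc n → X) (K : ℕ → NNReal),
      (∀ i, LipschitzOnWith (K i) (f i) (F i)) ∧
      μH[n] (E \ ⋃ i, f i '' F i) = 0

/-- The space of bounded `L`-Lipschitz functions `X → ℝ^m` with the supremum metric. -/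
abbrev LipE (L : NNReal) (X : Type*) [MetricSpace X] (m : ℕ) :=
  {f : BoundedContinuousFunction X (Euc m) // LipschitzWith L ⇑f}

theorem hausdorffMeasure_image_le_of_dist_le {α X Y : Type*} [MetricSpace X] [MeasurableSpace X]
    [BorelSpace X] [MetricSpace Y] [MeasurableSpace Y] [BorelSpace Y] {φ : α → X} {β : α → Y}
    {s : Set α} {K : NNReal} {d : ℝ} (hd : 0 ≤ d)
    (h : ∀ x ∈ s, ∀ y ∈ s, dist (φ x) (φ y) ≤ K * dist (β x) (β y)) :
    μH[d] (φ '' s) ≤ (K : ℝ≥0∞) ^ d * μH[d] (β '' s) := by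
  rcases s.eq_empty_or_nonempty with rfl | ⟨x₀, hx₀⟩
  · simp
  have : Nonempty α := ⟨x₀⟩
  set g : Y → α := Function.invFunOn β s
  have hg : ∀ x ∈ s, g (β x) ∈ s ∧ β (g (β x)) = β x := fun x hx =>
    ⟨Function.invFunOn_mem ⟨x, hx, rfl⟩, Function.invFunOn_eq ⟨x, hx, rfl⟩⟩
  have hφ : ∀ x ∈ s, φ (g (β x)) = φ x := by
    intro x hx
    have := h _ (hg x hx).1 x hx
    rw [(hg x hx).2, dist_self, mul_zero] at this
    exact dist_le_zero.1 this
  have hL : LipschitzOnWith K (φ ∘ g) (β '' s) := by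
    refine LipschitzOnWith.of_dist_le_mul ?_
    rintro _ ⟨x, hx, rfl⟩ _ ⟨y, hy, rfl⟩
    simp only [Function.comp_apply, hφ x hx, hφ y hy]
    exact h x hx y hy
  have := hL.hausdorffMeasure_image_le hd
  rwa [image_image, image_congr (f := fun x => (φ ∘ g) (β x)) (g := φ) (fun x hx => hφ x hx)] at this

/-- Multiplicity of `f` over `y` on `S`. -/
theorem lintegral_encard_fiber_le {X Y : Type*} [MetricSpace X] [MeasurableSpace X] [BorelSpace X]
    [SecondCountableTopology X] [MetricSpace Y] [MeasurableSpace Y] [BorelSpace Y]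
    {f : X → Y} (hf : LipschitzWith 1 f) {d : ℝ} (hd : 0 ≤ d) (S : Set X) :
    ∫⁻ y, (({x | x ∈ S ∧ f x = y}.encard : ℝ≥0∞)) ∂(μH[d] : Measure Y) ≤ μH[d] S := by
  set q : (l : ℕ) → X → (Fin l → Bool) := fun l x i => MeasurableSpace.mapNatBool X x i
  have hq : ∀ l, Measurable (q l) := fun l =>
    measurable_pi_lambda _ fun i => (measurable_pi_apply _).comp
      (MeasurableSpace.measurable_mapNatBool X)
  set T : (l : ℕ) → (Fin l → Bool) → Set Y :=
    fun l z => toMeasurable μH[d] (f '' (S ∩ q l ⁻¹' {z}))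
  set G : ℕ → Y → ℝ≥0∞ := fun l y => ∑ z, (T l z).indicator 1 y
  have hGm : ∀ l, Measurable (G l) := fun l =>
    Finset.measurable_sum _ fun z _ => measurable_one.indicator (measurableSet_toMeasurable _ _)
  have hGi : ∀ l, ∫⁻ y, G l y ∂(μH[d] : Measure Y) ≤ μH[d] S := by
    intro l
    rw [lintegral_finsetSum _ fun z _ =>
      measurable_one.indicator (measurableSet_toMeasurable _ _)]
    calc ∑ z, ∫⁻ y, (T l z).indicator 1 y ∂(μH[d] : Measure Y)
        ≤ ∑ z, μH[d] (S ∩ q l ⁻¹' {z}) := by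
          refine Finset.sum_le_sum fun z _ => ?_
          rw [lintegral_indicator_one (measurableSet_toMeasurable _ _), measure_toMeasurable]
          simpa using hf.hausdorffMeasure_image_le hd (S ∩ q l ⁻¹' {z})
      _ = μH[d] S := by
          have := measure_biUnion_finset (μ := (μH[d] : Measure X).restrict S)
            (s := Finset.univ) (f := fun z => q l ⁻¹' {z})
            (fun z _ w _ hzw => Disjoint.preimage _ (by simpa using hzw))
            (fun z _ => hq l (measurableSet_singleton z))
          simp only [Measure.restrict_apply (hq l (measurableSet_singleton _))] at this
          simp_rw [inter_comm S]
          rw [← this]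
          have h2 : ⋃ z ∈ (Finset.univ : Finset (Fin l → Bool)), q l ⁻¹' {z} = univ := by
            ext x; simp
          rw [h2, Measure.restrict_apply_univ]
  have hle : ∀ y, (({x | x ∈ S ∧ f x = y}.encard : ℝ≥0∞)) ≤ liminf (fun l => G l y) atTop := by
    intro y
    have key : ∀ t : Finset X, (t : Set X) ⊆ {x | x ∈ S ∧ f x = y} →
        (t.card : ℝ≥0∞) ≤ liminf (fun l => G l y) atTop := by
      intro t ht
      refine le_liminf_of_le (by isBoundedDefault) ?_
      have hsep : ∀ᶠ l in atTop, ∀ p ∈ t ×ˢ t, q l p.1 = q l p.2 → p.1 = p.2 := by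
        rw [eventually_all_finset]
        rintro ⟨a, b⟩ -
        by_cases hab : a = b
        · simp [hab]
        · have := fun h => hab (MeasurableSpace.injective_mapNatBool X h)
          obtain ⟨i, hi⟩ := Function.ne_iff.1 this
          filter_upwards [eventually_gt_atTop i] with l hl heq
          exact absurd (congrFun heq ⟨i, hl⟩) hi
      filter_upwards [hsep] with l hl
      have hinj : Set.InjOn (q l) t := fun a ha b hb h => hl (a, b) (by simp_all) h
      classical
      calc (t.card : ℝ≥0∞) = ∑ z ∈ t.image (q l), 1 := by
            rw [Finset.sum_const, Finset.card_image_of_injOn hinj]; simp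
        _ ≤ ∑ z ∈ t.image (q l), (T l z).indicator 1 y := by
            refine Finset.sum_le_sum fun z hz => ?_
            obtain ⟨x, hx, rfl⟩ := Finset.mem_image.1 hz
            have : y ∈ T l (q l x) :=
              subset_toMeasurable _ _ ⟨x, ⟨(ht hx).1, rfl⟩, (ht hx).2⟩
            simp [this]
        _ ≤ G l y := Finset.sum_le_sum_of_subset (Finset.subset_univ _)
    set F := {x | x ∈ S ∧ f x = y} with hF
    by_cases hfin : F.Finite
    · have := key hfin.toFinset (by simp)
      rwa [hfin.encard_eq_coe_toFinset_card]
    · have hinf : F.Infinite := hfin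
      rw [hinf.encard_eq]
      simp only [ENat.toENNReal_top, top_le_iff]
      refine ENNReal.eq_top_of_forall_nnreal_le fun r => ?_
      obtain ⟨N, hN⟩ := exists_nat_ge r
      obtain ⟨t, ht, htc⟩ := hinf.exists_subset_card_eq N
      refine le_trans ?_ (key t ht)
      rw [htc]; exact_mod_cast hN
  calc _ ≤ ∫⁻ y, liminf (fun l => G l y) atTop ∂(μH[d] : Measure Y) := lintegral_mono hle
    _ ≤ liminf (fun l => ∫⁻ y, G l y ∂(μH[d] : Measure Y)) atTop := lintegral_liminf_le hGm
    _ ≤ μH[d] S := by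
      refine (liminf_le_liminf (Eventually.of_forall hGi)).trans ?_
      simp

theorem measure_image_le_lintegral_encard_fiber {X Y : Type*} [MeasurableSpace Y] {μ : Measure Y}
    {f : X → Y} {S : Set X} (hS : MeasurableSet (f '' S)) :
    μ (f '' S) ≤ ∫⁻ y, (({x | x ∈ S ∧ f x = y}.encard : ℝ≥0∞)) ∂μ := by
  rw [← lintegral_indicator_one hS]
  refine lintegral_mono fun y => ?_
  by_cases hy : y ∈ f '' S
  swap
  · simp [indicator_of_notMem hy]
  rw [indicator_of_mem hy, Pi.one_apply]
  obtain ⟨x, hx, rfl⟩ := hy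
  have : (1 : ℕ∞) ≤ {x' | x' ∈ S ∧ f x' = f x}.encard :=
    one_le_encard_iff_nonempty.2 ⟨x, hx, rfl⟩
  simpa using ENat.toENNReal_le.2 this

theorem tsum_lintegral_encard_fiber_le {X Y ι : Type*} [MeasurableSpace Y] {μ : Measure Y}
    {f : X → Y} {S : ι → Set X} (hS : Pairwise (Function.onFun Disjoint S)) {U : Set X}
    (hU : ∀ i, S i ⊆ U) :
    ∑' i, ∫⁻ y, (({x | x ∈ S i ∧ f x = y}.encard : ℝ≥0∞)) ∂μ ≤
      ∫⁻ y, (({x | x ∈ U ∧ f x = y}.encard : ℝ≥0∞)) ∂μ := by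
  have key : ∀ s : Finset ι, ∑ i ∈ s, ∫⁻ y, (({x | x ∈ S i ∧ f x = y}.encard : ℝ≥0∞)) ∂μ ≤
      ∫⁻ y, (({x | x ∈ ⋃ i ∈ s, S i ∧ f x = y}.encard : ℝ≥0∞)) ∂μ := by
    classical
    intro s
    induction s using Finset.induction_on with
    | empty => simp
    | insert a s ha ih =>
      rw [Finset.sum_insert ha]
      refine (add_le_add_right ih _).trans ((le_lintegral_add _ _).trans ?_)
      refine lintegral_mono fun y => ?_
      simp only
      rw [← ENat.toENNReal_add, ← encard_union_eq]
      · refine ENat.toENNReal_le.2 (encard_le_encard ?_)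
        rintro x (⟨hx, rfl⟩ | ⟨hx, rfl⟩) <;> simp_all
      · rw [disjoint_left]
        rintro x ⟨hx, -⟩ ⟨hx', -⟩
        simp only [mem_iUnion, exists_prop] at hx'
        obtain ⟨i, hi, hxi⟩ := hx'
        exact disjoint_left.1 (hS (show a ≠ i from fun h => ha (h ▸ hi))) hx hxi
  rw [ENNReal.tsum_eq_iSup_sum]
  refine iSup_le fun s => (key s).trans (lintegral_mono fun y => ?_)
  refine ENat.toENNReal_le.2 (encard_le_encard ?_)
  rintro x ⟨hx, rfl⟩
  simp only [mem_iUnion, exists_prop] at hx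
  obtain ⟨i, _, hxi⟩ := hx
  exact ⟨hU i hxi, rfl⟩

/-- Every direction is a limit of rescaled displacements from `x` to points of `T`. -/
def FullTangent {X : Type*} [NormedAddCommGroup X] [NormedSpace ℝ X] (T : Set X) (x : X) : Prop :=
  ∀ v : X, ∃ (c : ℕ → ℝ) (d : ℕ → X), (∀ n, 0 ≤ c n) ∧ Tendsto d atTop (𝓝 0) ∧
    (∀ n, x + d n ∈ T) ∧ Tendsto (fun n => c n • d n) atTop (𝓝 v)

theorem ae_fullTangent {X : Type*} [NormedAddCommGroup X] [NormedSpace ℝ X] [FiniteDimensional ℝ X]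
    [MeasurableSpace X] [BorelSpace X] (μ : Measure X) [μ.IsAddHaarMeasure] (T : Set X) :
    ∀ᵐ x ∂μ.restrict T, FullTangent T x := by
  filter_upwards [Besicovitch.ae_tendsto_measure_inter_div μ T] with x hx v
  have key : ∀ n : ℕ, ∃ (r : ℝ) (y : X), 0 < r ∧ r < 1 / ((n : ℝ) + 1) ∧ y ∈ T ∧
      ‖r⁻¹ • (y - x) - v‖ ≤ 1 / ((n : ℝ) + 1) := by
    intro n
    have hn : (0 : ℝ) < 1 / ((n : ℝ) + 1) := Nat.one_div_pos_of_nat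
    have B := Measure.eventually_nonempty_inter_smul_of_density_one μ T x hx
      (closedBall v (1 / ((n : ℝ) + 1))) measurableSet_closedBall
      (measure_closedBall_pos μ v hn).ne'
    obtain ⟨r, ⟨y, hyT, hy⟩, hr⟩ := (B.and (Ioo_mem_nhdsGT hn)).exists
    refine ⟨r, y, hr.1, hr.2, hyT, ?_⟩
    simp only [singleton_add, image_add_left, mem_preimage] at hy
    obtain ⟨w, hw, hwy⟩ := mem_smul_set.1 hy
    have : y - x = r • w := by rw [hwy]; abel
    rw [this, smul_smul, inv_mul_cancel₀ hr.1.ne', one_smul]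
    simpa [dist_eq_norm] using hw
  choose r y hr0 hr hy hv using key
  have hlim : Tendsto (fun n => (r n)⁻¹ • (y n - x)) atTop (𝓝 v) := by
    rw [tendsto_iff_norm_sub_tendsto_zero]
    exact squeeze_zero (fun _ => norm_nonneg _) hv tendsto_one_div_add_atTop_nhds_zero_nat
  refine ⟨fun n => (r n)⁻¹, fun n => y n - x, fun n => (inv_pos.2 (hr0 n)).le, ?_,
    fun n => by simpa using hy n, hlim⟩
  have hr' : Tendsto r atTop (𝓝 0) :=
    squeeze_zero (fun n => (hr0 n).le) (fun n => (hr n).le)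
      tendsto_one_div_add_atTop_nhds_zero_nat
  have := hr'.smul hlim
  simp only [zero_smul] at this
  refine this.congr fun n => ?_
  rw [smul_smul, mul_inv_cancel₀ (hr0 n).ne', one_smul]

theorem FullTangent.norm_fderiv_le {X V W : Type*} [NormedAddCommGroup X] [NormedSpace ℝ X]
    [NormedAddCommGroup V] [NormedSpace ℝ V] [NormedAddCommGroup W] [NormedSpace ℝ W]
    {T : Set X} {x : X} (hx : FullTangent T x) {f : X → V} {g : X → W} {f' : X →L[ℝ] V}
    {g' : X →L[ℝ] W} (hf : HasFDerivAt f f' x) (hg : HasFDerivAt g g' x) {c : ℝ}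
    (h : ∀ y ∈ T, ‖f y - f x‖ ≤ ‖g y - g x‖ + c * ‖y - x‖) (v : X) :
    ‖f' v‖ ≤ ‖g' v‖ + c * ‖v‖ := by
  obtain ⟨a, d, ha, hd, hT, had⟩ := hx v
  have h1 := (hf.hasFDerivWithinAt (s := univ)).lim hd (by simp) had
  have h2 := (hg.hasFDerivWithinAt (s := univ)).lim hd (by simp) had
  refine le_of_tendsto_of_tendsto' h1.norm (h2.norm.add (had.norm.const_mul c)) fun n => ?_
  have := h _ (hT n)
  rw [norm_smul, norm_smul, norm_smul, Real.norm_of_nonneg (ha n)]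
  rw [add_sub_cancel_left] at this
  nlinarith [ha n]

theorem norm_fderiv_apply_le {X V : Type*} [NormedAddCommGroup X] [NormedSpace ℝ X]
    [NormedAddCommGroup V] [NormedSpace ℝ V] {C : NNReal}
    {f : X → V} (hf : LipschitzWith C f) (x v : X) : ‖fderiv ℝ f x v‖ ≤ C * ‖v‖ :=
  (fderiv ℝ f x).le_of_opNorm_le (norm_fderiv_le_of_lipschitz ℝ hf) v

theorem integrableOn_norm_fderiv_sq {X V : Type*} [NormedAddCommGroup X]
    [NormedSpace ℝ X] [FiniteDimensional ℝ X] [MeasurableSpace X] [BorelSpace X] {μ : Measure X}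
    [NormedAddCommGroup V] [NormedSpace ℝ V]
    [CompleteSpace V] {C : NNReal} {f : X → V} (hf : LipschitzWith C f) {T : Set X}
    (hTf : μ T ≠ ∞) (v : X) : IntegrableOn (fun x => ‖fderiv ℝ f x v‖ ^ 2) T μ := by
  borelize V
  refine Measure.integrableOn_of_bounded hTf
    ((measurable_fderiv_apply_const ℝ f v).norm.pow_const 2).aestronglyMeasurable
    (M := (C * ‖v‖) ^ 2) (Eventually.of_forall fun x => ?_)
  rw [norm_pow, norm_norm]
  gcongr
  exact norm_fderiv_apply_le hf x v

section Weak

variable {X : Type*} [NormedAddCommGroup X] [NormedSpace ℝ X] [FiniteDimensional ℝ X]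
  [MeasurableSpace X] [BorelSpace X] {μ : Measure X} [μ.IsAddHaarMeasure]

theorem exists_abs_integral_mul_fderiv_le {w : X → ℝ} (hw : Integrable w μ) (C : NNReal) (v : X)
    {ε : ℝ} (hε : 0 < ε) :
    ∃ ρ > 0, ∀ d : X → ℝ, LipschitzWith C d → (∀ x, |d x| ≤ ρ) →
      |∫ x, w x * fderiv ℝ d x v ∂μ| ≤ ε := by
  set ε' := ε / (2 * (C * ‖v‖ + 1)) with hε'
  have hC : 0 ≤ C * ‖v‖ := by positivity
  have hε'0 : 0 < ε' := by positivity
  obtain ⟨g, hgc, hg, hwg⟩ := (memLp_one_iff_integrable.2 hw).exist_eLpNorm_sub_le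
    (by simp) le_rfl hε'0
  obtain ⟨D, hD⟩ := hg.lipschitzWith_of_hasCompactSupport hgc (by simp)
  have hgi : Integrable g μ := hg.continuous.integrable_of_hasCompactSupport hgc
  have hdi : Integrable (fun x => fderiv ℝ g x (-v)) μ :=
    ((hg.continuous_fderiv (by simp)).clm_apply continuous_const).integrable_of_hasCompactSupport
      (hgc.fderiv_apply ℝ (-v))
  have hwg' : ∫ x, ‖w x - g x‖ ∂μ ≤ ε' := by
    change ∫ x, ‖(w - g) x‖ ∂μ ≤ ε'
    rw [integral_norm_eq_lintegral_enorm (hw.sub hgi).1]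
    refine ENNReal.toReal_le_of_le_ofReal hε'0.le ?_
    rw [← eLpNorm_one_eq_lintegral_enorm]
    exact hwg
  set I := ∫ x, ‖fderiv ℝ g x (-v)‖ ∂μ with hI
  have hI0 : 0 ≤ I := integral_nonneg fun _ => norm_nonneg _
  refine ⟨ε / (2 * (I + 1)), by positivity, fun d hd hρ => ?_⟩
  have hmeas : AEStronglyMeasurable (fun x => fderiv ℝ d x v) μ :=
    (measurable_fderiv_apply_const ℝ d v).aestronglyMeasurable
  have hbd : ∀ᵐ x ∂μ, ‖fderiv ℝ d x v‖ ≤ C * ‖v‖ :=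
    Eventually.of_forall fun x => norm_fderiv_apply_le hd x v
  have hi1 : Integrable (fun x => (w x - g x) * fderiv ℝ d x v) μ :=
    (hw.sub hgi).mul_bdd hmeas hbd
  have hi2 : Integrable (fun x => g x * fderiv ℝ d x v) μ := hgi.mul_bdd hmeas hbd
  have hsplit : ∫ x, w x * fderiv ℝ d x v ∂μ =
      ∫ x, (w x - g x) * fderiv ℝ d x v ∂μ + ∫ x, g x * fderiv ℝ d x v ∂μ := by
    rw [← integral_add hi1 hi2]; congr 1; ext x; ring
  have h1 : |∫ x, (w x - g x) * fderiv ℝ d x v ∂μ| ≤ ε / 2 := by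
    calc |∫ x, (w x - g x) * fderiv ℝ d x v ∂μ|
        ≤ ∫ x, ‖w x - g x‖ * (C * ‖v‖) ∂μ := by
          rw [← Real.norm_eq_abs]
          refine norm_integral_le_of_norm_le ((hw.sub hgi).norm.mul_const _) ?_
          filter_upwards [hbd] with x hx
          rw [norm_mul]
          gcongr
      _ = (∫ x, ‖w x - g x‖ ∂μ) * (C * ‖v‖) := integral_mul_const _ _
      _ ≤ ε' * (C * ‖v‖) := by gcongr
      _ ≤ ε / 2 := by
          rw [hε', div_mul_eq_mul_div, div_le_div_iff₀ (by positivity) (by positivity)]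
          nlinarith
  have h2 : |∫ x, g x * fderiv ℝ d x v ∂μ| ≤ ε / 2 := by
    have heq : ∫ x, g x * fderiv ℝ d x v ∂μ = ∫ x, fderiv ℝ g x (-v) * d x ∂μ := by
      have := hd.integral_lineDeriv_mul_eq (μ := μ) hD hgc v
      have e1 : ∫ x, g x * fderiv ℝ d x v ∂μ = ∫ x, lineDeriv ℝ d x v * g x ∂μ := by
        refine integral_congr_ae ?_
        filter_upwards [hd.ae_differentiableAt (μ := μ)] with x hx
        rw [hx.lineDeriv_eq_fderiv, mul_comm]
      rw [e1, this]
      congr 1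
      ext x
      rw [((hg.differentiable (by simp)) x).lineDeriv_eq_fderiv]
    rw [heq, ← Real.norm_eq_abs]
    calc ‖∫ x, fderiv ℝ g x (-v) * d x ∂μ‖
        ≤ ∫ x, ‖fderiv ℝ g x (-v)‖ * (ε / (2 * (I + 1))) ∂μ := by
          refine norm_integral_le_of_norm_le (hdi.norm.mul_const _) ?_
          refine Eventually.of_forall fun x => ?_
          rw [norm_mul]
          gcongr
          exact hρ x
      _ = I * (ε / (2 * (I + 1))) := integral_mul_const _ _
      _ ≤ ε / 2 := by
          rw [mul_div_assoc', div_le_div_iff₀ (by positivity) (by positivity)]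
          nlinarith
  rw [hsplit]
  exact (abs_add_le _ _).trans (by linarith)

theorem exists_abs_setIntegral_mul_fderiv_le {T : Set X} (hT : MeasurableSet T) {w : X → ℝ}
    (hw : IntegrableOn w T μ) (C : NNReal) (v : X) {ε : ℝ} (hε : 0 < ε) :
    ∃ ρ > 0, ∀ d : X → ℝ, LipschitzWith C d → (∀ x ∈ T, |d x| ≤ ρ) →
      |∫ x in T, w x * fderiv ℝ d x v ∂μ| ≤ ε := by
  obtain ⟨ρ, hρ, H⟩ := exists_abs_integral_mul_fderiv_le
    ((integrable_indicator_iff hT).2 hw) C v hε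
  refine ⟨ρ, hρ, fun d hd hdT => ?_⟩
  set d' : X → ℝ := fun x => max (-ρ) (min (d x) ρ)
  have hd' : LipschitzWith C d' := (hd.min_const ρ).const_max (-ρ)
  have hdd : ∀ x ∈ T, d' x = d x := fun x hx => by
    have := abs_le.1 (hdT x hx)
    simp only [d', min_eq_left this.2, max_eq_right this.1]
  have := H d' hd' fun x => abs_le.2 ⟨le_max_left _ _, max_le (by linarith) (min_le_right _ _)⟩
  convert this using 2
  rw [← integral_indicator hT]
  refine integral_congr_ae ?_
  have h1 := (ae_restrict_iff' hT).1 (ae_fullTangent μ T)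
  filter_upwards [h1, hd.ae_differentiableAt (μ := μ), hd'.ae_differentiableAt (μ := μ)]
    with x hx hx1 hx2
  by_cases hxT : x ∈ T
  · rw [indicator_of_mem hxT, indicator_of_mem hxT]
    congr 1
    have := (hx hxT).norm_fderiv_le (hx1.hasFDerivAt.sub hx2.hasFDerivAt)
      (hasFDerivAt_const (0 : ℝ) x) (c := 0) (fun y hy => by simp [hdd y hy, hdd x hxT]) v
    simp only [sub_apply, zero_apply, norm_zero, zero_mul,
      add_zero, norm_le_zero_iff] at this
    linarith
  · simp [indicator_of_notMem hxT]

theorem lowerSemicontinuous_energy {m : ℕ} {T : Set X} (hT : MeasurableSet T) (hTf : μ T ≠ ∞)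
    {C : NNReal} {h₀ : X → EuclideanSpace ℝ (Fin m)} (hh₀ : LipschitzWith C h₀) (v : X) {c : ℝ}
    (hc : c < ∫ x in T, ‖fderiv ℝ h₀ x v‖ ^ 2 ∂μ) :
    ∃ ρ > 0, ∀ h : X → EuclideanSpace ℝ (Fin m), LipschitzWith C h →
      (∀ x ∈ T, ‖h x - h₀ x‖ ≤ ρ) → c < ∫ x in T, ‖fderiv ℝ h x v‖ ^ 2 ∂μ := by
  set I := ∫ x in T, ‖fderiv ℝ h₀ x v‖ ^ 2 ∂μ
  have hpr : ∀ (j : Fin m) (a : EuclideanSpace ℝ (Fin m)), |a j| ≤ ‖a‖ := fun j a =>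
    PiLp.norm_apply_le a j
  have hmj : ∀ (h : X → EuclideanSpace ℝ (Fin m)) (j : Fin m),
      Measurable fun x => (fderiv ℝ h x v) j := fun h j =>
    (EuclideanSpace.proj (𝕜 := ℝ) j).continuous.measurable.comp
      (measurable_fderiv_apply_const ℝ h v)
  have hbj : ∀ (h : X → EuclideanSpace ℝ (Fin m)), LipschitzWith C h → ∀ (j : Fin m) x,
      ‖(fderiv ℝ h x v) j‖ ≤ C * ‖v‖ := fun h hh j x =>
    (hpr j _).trans (norm_fderiv_apply_le hh x v)
  have hij : ∀ (h : X → EuclideanSpace ℝ (Fin m)), LipschitzWith C h → ∀ (j : Fin m),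
      IntegrableOn (fun x => (fderiv ℝ h x v) j) T μ := fun h hh j =>
    Measure.integrableOn_of_bounded hTf (hmj h j).aestronglyMeasurable
      (Eventually.of_forall (hbj h hh j))
  have hε : 0 < (I - c) / (4 * (m + 1)) := by
    have : 0 < I - c := by linarith
    positivity
  have := fun j : Fin m => exists_abs_setIntegral_mul_fderiv_le hT (hij h₀ hh₀ j) (C + C) v hε
  choose r hr H using this
  obtain ⟨ρ, hρ, hρr⟩ : ∃ ρ > 0, ∀ j, ρ ≤ r j := by
    have : ∀ᶠ ρ in 𝓝[>] (0 : ℝ), ∀ j, ρ ≤ r j :=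
      eventually_all.2 fun j => mem_of_superset (Ioo_mem_nhdsGT (hr j)) fun _ h => h.2.le
    obtain ⟨ρ, h1, h2⟩ := (this.and self_mem_nhdsWithin).exists
    exact ⟨ρ, h2, h1⟩
  refine ⟨ρ, hρ, fun h hh hρT => ?_⟩
  set d : Fin m → X → ℝ := fun j x => h x j - h₀ x j
  have hcomp : ∀ (h : X → EuclideanSpace ℝ (Fin m)), LipschitzWith C h → ∀ j,
      LipschitzWith C fun x => h x j := fun h hh j =>
    LipschitzWith.of_dist_le_mul fun x y => by
      rw [Real.dist_eq, ← PiLp.sub_apply]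
      exact (hpr j _).trans (by rw [← dist_eq_norm]; exact hh.dist_le_mul x y)
  have hd : ∀ j, LipschitzWith (C + C) (d j) := fun j => (hcomp h hh j).sub (hcomp h₀ hh₀ j)
  have hsmall : ∀ j, |∫ x in T, (fderiv ℝ h₀ x v) j * fderiv ℝ (d j) x v ∂μ| ≤
      (I - c) / (4 * (m + 1)) := fun j => H j (d j) (hd j) fun x hx =>
    ((hpr j (h x - h₀ x)).trans (hρT x hx)).trans (hρr j)
  have hprod : ∀ j, IntegrableOn (fun x => (fderiv ℝ h₀ x v) j * fderiv ℝ (d j) x v) T μ :=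
    fun j => (hij h₀ hh₀ j).mul_bdd
      (measurable_fderiv_apply_const ℝ (d j) v).aestronglyMeasurable
      (Eventually.of_forall fun x => norm_fderiv_apply_le (hd j) x v)
  have hge : I + ∑ j, 2 * ∫ x in T, (fderiv ℝ h₀ x v) j * fderiv ℝ (d j) x v ∂μ ≤
      ∫ x in T, ‖fderiv ℝ h x v‖ ^ 2 ∂μ := by
    simp_rw [← integral_const_mul]
    rw [← integral_finsetSum _ fun j _ => (hprod j).const_mul 2,
      ← integral_add (integrableOn_norm_fderiv_sq hh₀ hTf v)
        (integrable_finsetSum _ fun j _ => (hprod j).const_mul 2)]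
    refine integral_mono_ae ((integrableOn_norm_fderiv_sq hh₀ hTf v).add
        (integrable_finsetSum _ fun j _ => (hprod j).const_mul 2))
      (integrableOn_norm_fderiv_sq hh hTf v) (ae_restrict_of_ae ?_)
    filter_upwards [hh.ae_differentiableAt (μ := μ), hh₀.ae_differentiableAt (μ := μ)]
      with x hx hx0
    have hfd : ∀ j, fderiv ℝ (d j) x v = fderiv ℝ h x v j - fderiv ℝ h₀ x v j := fun j => by
      have h1 := ((EuclideanSpace.proj (𝕜 := ℝ) j).hasFDerivAt.comp x
        (hx.hasFDerivAt.sub hx0.hasFDerivAt))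
      have h2 : HasFDerivAt (d j) ((EuclideanSpace.proj (𝕜 := ℝ) j).comp
        (fderiv ℝ h x - fderiv ℝ h₀ x)) x := h1
      rw [h2.fderiv]
      simp
    simp only [EuclideanSpace.norm_sq_eq, Real.norm_eq_abs, sq_abs, hfd]
    rw [← Finset.sum_add_distrib]
    refine Finset.sum_le_sum fun j _ => ?_
    nlinarith [sq_nonneg (fderiv ℝ h x v j - fderiv ℝ h₀ x v j)]
  have hsum : -((I - c) / 2) ≤
      ∑ j, 2 * ∫ x in T, (fderiv ℝ h₀ x v) j * fderiv ℝ (d j) x v ∂μ := by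
    calc -((I - c) / 2) ≤ ∑ _j : Fin m, 2 * -((I - c) / (4 * (m + 1))) := by
          rw [Finset.sum_const, Finset.card_univ, Fintype.card_fin, nsmul_eq_mul]
          have : (m : ℝ) * (2 * -((I - c) / (4 * (m + 1)))) =
            -((I - c) / 2) * (m / (m + 1)) := by field_simp; ring
          rw [this]
          have h1 : (m : ℝ) / (m + 1) ≤ 1 := by
            rw [div_le_one (by positivity)]; linarith
          have h2 : (0 : ℝ) ≤ m / (m + 1) := by positivity
          nlinarith
      _ ≤ _ := by
          refine Finset.sum_le_sum fun j _ => ?_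
          have := (abs_le.1 (hsmall j)).1
          linarith
  linarith

end Weak

theorem exists_clm_norm_add_le_of_ker {X Y : Type*} [NormedAddCommGroup X] [InnerProductSpace ℝ X]
    [FiniteDimensional ℝ X] [NormedAddCommGroup Y] [NormedSpace ℝ Y] (A : X →L[ℝ] Y) {v : X}
    (hv : v ≠ 0) (hA : A v = 0) {ε : ℝ} (hε : 0 < ε) :
    ∃ (B : X →L[ℝ] X) (r : NNReal), r ≠ 0 ∧ (∀ z, ‖A z‖ + r * ‖z‖ ≤ ‖B z‖) ∧
      |LinearMap.det (B : X →ₗ[ℝ] X)| ≤ ε := by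
  set u : X := ‖v‖⁻¹ • v with hu_def
  have hu : ‖u‖ = 1 := norm_smul_inv_norm hv
  have hAu : A u = 0 := by rw [hu_def, map_smul, hA, smul_zero]
  have huu : inner ℝ u u = (1 : ℝ) := by rw [real_inner_self_eq_norm_sq, hu]; norm_num
  set c : ℝ := 2 * (‖A‖ + 1)
  have hc : 0 < c := by positivity
  set B : ℝ → X →L[ℝ] X := fun δ =>
    c • (ContinuousLinearMap.id ℝ X - (1 - δ) • (innerSL ℝ u).smulRight u)
  have hB : ∀ δ z, B δ z = c • (z - (1 - δ) • (inner ℝ u z) • u) := fun δ z => by simp [B]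
  have hcont : Continuous fun δ => |LinearMap.det (B δ : X →ₗ[ℝ] X)| := by
    have : Continuous B := by fun_prop
    exact (ContinuousLinearMap.continuous_det.comp this).abs
  have h0 : LinearMap.det (B 0 : X →ₗ[ℝ] X) = 0 := by
    refine LinearMap.det_eq_zero_iff_ker_ne_bot.2 fun h => ?_
    have : u ∈ (B 0 : X →ₗ[ℝ] X).ker := by
      rw [LinearMap.mem_ker]
      change B 0 u = 0
      rw [hB, huu]
      simp
    rw [h, Submodule.mem_bot] at this
    simp [this] at hu
  have hev : ∀ᶠ δ in 𝓝[>] (0 : ℝ), |LinearMap.det (B δ : X →ₗ[ℝ] X)| < ε := by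
    refine (hcont.tendsto 0).mono_left nhdsWithin_le_nhds |>.eventually_lt_const ?_
    simpa [h0] using hε
  obtain ⟨δ, hδε, hδ0, hδ1⟩ := (hev.and (Ioo_mem_nhdsGT zero_lt_one)).exists
  refine ⟨B δ, NNReal.mk δ hδ0.le, fun h => hδ0.ne' (congrArg NNReal.toReal h), fun z => ?_, hδε.le⟩
  set t : ℝ := inner ℝ u z
  set q : X := z - t • u with hq
  have hz : z = q + t • u := by rw [hq]; abel
  have hBz : B δ z = c • (q + (δ * t) • u) := by
    rw [hB, hq]
    congr 1
    rw [smul_smul]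
    module
  have hqu : inner ℝ u q = (0 : ℝ) := by
    rw [hq, inner_sub_right, inner_smul_right, huu]; simp [t]
  have hsq : ‖q + (δ * t) • u‖ ^ 2 = ‖q‖ ^ 2 + (δ * |t|) ^ 2 := by
    rw [norm_add_sq_real, inner_smul_right, real_inner_comm, hqu, norm_smul, hu]
    simp [mul_pow]
  have h1 : ‖q‖ ≤ ‖q + (δ * t) • u‖ :=
    le_of_sq_le_sq (by rw [hsq]; nlinarith [sq_nonneg (δ * |t|)]) (norm_nonneg _)
  have h2 : δ * |t| ≤ ‖q + (δ * t) • u‖ :=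
    le_of_sq_le_sq (by rw [hsq]; nlinarith [sq_nonneg ‖q‖]) (norm_nonneg _)
  have h3 : ‖A z‖ ≤ ‖A‖ * ‖q‖ := by
    rw [hz, map_add, map_smul, hAu, smul_zero, add_zero]
    exact A.le_opNorm q
  have h4 : ‖z‖ ≤ ‖q‖ + |t| := by
    conv_lhs => rw [hz]
    refine (norm_add_le _ _).trans ?_
    rw [norm_smul, hu, mul_one, Real.norm_eq_abs]
  rw [hBz, norm_smul, Real.norm_of_nonneg hc.le, NNReal.coe_mk]
  have hA0 := norm_nonneg A
  calc ‖A z‖ + δ * ‖z‖ ≤ ‖A‖ * ‖q‖ + (δ * ‖q‖ + δ * |t|) := by nlinarith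
    _ ≤ ‖A‖ * ‖q‖ + (1 * ‖q‖ + δ * |t|) := by gcongr
    _ ≤ c * ‖q + (δ * t) • u‖ := by
        simp only [c]
        nlinarith [norm_nonneg (q + (δ * t) • u)]

theorem tsum_measure_inter_le {α : Type*} [MeasurableSpace α] (μ : Measure α) (S : Set α)
    {t : ℕ → Set α} (hd : Pairwise (Function.onFun Disjoint t)) (ht : ∀ j, MeasurableSet (t j)) :
    ∑' j, μ (S ∩ t j) ≤ μ S := by
  calc ∑' j, μ (S ∩ t j) = ∑' j, μ.restrict S (t j) := by
        congr 1; ext j; rw [Measure.restrict_apply (ht j), inter_comm]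
    _ = μ.restrict S (⋃ j, t j) := (measure_iUnion hd ht).symm
    _ ≤ μ S := by
        rw [← Measure.restrict_apply_univ S]
        exact measure_mono (subset_univ _)

/-- The part of `ℝ^n` where a map has degenerate derivative has `H^n`-null image. -/
theorem hausdorffMeasure_image_eq_zero_of_ker {X Y : Type*} [NormedAddCommGroup X]
    [InnerProductSpace ℝ X] [FiniteDimensional ℝ X] [MeasurableSpace X] [BorelSpace X]
    [NormedAddCommGroup Y] [NormedSpace ℝ Y] [SecondCountableTopology Y]
    [MeasurableSpace Y] [BorelSpace Y] {φ : X → Y} {S : Set X}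
    {φ' : X → X →L[ℝ] Y} (hφ : ∀ x ∈ S, HasFDerivWithinAt φ (φ' x) S x)
    (h0 : ∀ x ∈ S, ∃ v, v ≠ 0 ∧ φ' x v = 0) : μH[Module.finrank ℝ X] (φ '' S) = 0 := by
  have key : ∀ S' ⊆ S, μH[Module.finrank ℝ X] S' ≠ ∞ → μH[Module.finrank ℝ X] (φ '' S') = 0 := by
    intro S' hS' hfin
    rcases S'.eq_empty_or_nonempty with rfl | hne
    · simp
    have hε : ∀ ε : ℝ, 0 < ε → μH[Module.finrank ℝ X] (φ '' S') ≤
        ENNReal.ofReal ε * μH[Module.finrank ℝ X] S' := by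
      intro ε hε
      have : ∀ A : X →L[ℝ] Y, ∃ r : NNReal, r ≠ 0 ∧ ((∃ v, v ≠ 0 ∧ A v = 0) →
          ∃ B : X →L[ℝ] X, (∀ z, ‖A z‖ + r * ‖z‖ ≤ ‖B z‖) ∧
            |LinearMap.det (B : X →ₗ[ℝ] X)| ≤ ε) := by
        intro A
        by_cases hA : ∃ v, v ≠ 0 ∧ A v = 0
        · obtain ⟨v, hv, hAv⟩ := hA
          obtain ⟨B, r, hr, hB⟩ := exists_clm_norm_add_le_of_ker A hv hAv hε
          exact ⟨r, hr, fun _ => ⟨B, hB⟩⟩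
        · exact ⟨1, one_ne_zero, fun h => absurd h hA⟩
      choose r hr hB using this
      obtain ⟨t, A, hd, htm, hcov, happ, hA⟩ :=
        exists_partition_approximatesLinearOn_of_hasFDerivWithinAt φ S' φ'
          (fun x hx => (hφ x (hS' hx)).mono hS') r hr
      have hpiece : ∀ j, μH[Module.finrank ℝ X] (φ '' (S' ∩ t j)) ≤
          ENNReal.ofReal ε * μH[Module.finrank ℝ X] (S' ∩ t j) := by
        intro j
        obtain ⟨y, hy, hAy⟩ := hA hne j
        obtain ⟨B, hBz, hdet⟩ := hB (A j) (by rw [hAy]; exact h0 y (hS' hy))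
        have : μH[Module.finrank ℝ X] (φ '' (S' ∩ t j)) ≤
            ((1 : NNReal) : ℝ≥0∞) ^ (Module.finrank ℝ X : ℝ) *
              μH[Module.finrank ℝ X] (B '' (S' ∩ t j)) := by
          refine hausdorffMeasure_image_le_of_dist_le (by positivity) fun x hx y hy => ?_
          have h1 := happ j x hx y hy
          rw [dist_eq_norm, dist_eq_norm, ← map_sub, NNReal.coe_one, one_mul]
          refine le_trans ?_ (hBz (x - y))
          calc ‖φ x - φ y‖ = ‖A j (x - y) + (φ x - φ y - A j (x - y))‖ := by congr 1; abel
            _ ≤ _ := (norm_add_le _ _).trans (by gcongr)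
        rw [ENNReal.coe_one, ENNReal.one_rpow, one_mul,
          Measure.addHaar_image_continuousLinearMap] at this
        exact this.trans (by gcongr)
      calc μH[Module.finrank ℝ X] (φ '' S')
          ≤ μH[Module.finrank ℝ X] (⋃ j, φ '' (S' ∩ t j)) := by
            rw [← image_iUnion, ← inter_iUnion, inter_eq_left.2 hcov]
        _ ≤ ∑' j, μH[Module.finrank ℝ X] (φ '' (S' ∩ t j)) := measure_iUnion_le _
        _ ≤ ∑' j, ENNReal.ofReal ε * μH[Module.finrank ℝ X] (S' ∩ t j) :=
            ENNReal.tsum_le_tsum hpiece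
        _ ≤ _ := by
            rw [ENNReal.tsum_mul_left]
            gcongr
            exact tsum_measure_inter_le _ _ hd htm
    have hlim : Tendsto (fun ε : ℝ => ENNReal.ofReal ε * μH[Module.finrank ℝ X] S') (𝓝[>] 0)
        (𝓝 (ENNReal.ofReal 0 * μH[Module.finrank ℝ X] S')) :=
      (ENNReal.Tendsto.mul_const (ENNReal.tendsto_ofReal tendsto_id) (Or.inr hfin)).mono_left
        nhdsWithin_le_nhds
    have := ge_of_tendsto hlim (eventually_nhdsWithin_of_forall hε)
    simpa using this
  have hS : φ '' S = ⋃ N : ℕ, φ '' (S ∩ closedBall 0 N) := by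
    rw [← image_iUnion, ← inter_iUnion, iUnion_closedBall_nat, inter_univ]
  rw [hS]
  refine measure_iUnion_null fun N => key _ inter_subset_left ?_
  exact ((measure_mono inter_subset_right).trans_lt measure_closedBall_lt_top).ne

section Kirszbraun

variable {H₁ H₂ : Type*} [NormedAddCommGroup H₁] [InnerProductSpace ℝ H₁]
  [NormedAddCommGroup H₂] [InnerProductSpace ℝ H₂]

theorem sum_mul_norm_sub_sq {ι : Type*} [Fintype ι] {l : ι → ℝ} (hl : ∑ i, l i = 1) (y : ι → H₁) :
    ∑ i, ∑ j, l i * l j * ‖y i - y j‖ ^ 2 =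
      2 * ∑ i, l i * ‖y i‖ ^ 2 - 2 * ‖∑ i, l i • y i‖ ^ 2 := by
  have h1 : ‖∑ i, l i • y i‖ ^ 2 = ∑ i, ∑ j, l i * l j * inner ℝ (y i) (y j) := by
    rw [← real_inner_self_eq_norm_sq, sum_inner]
    refine Finset.sum_congr rfl fun i _ => ?_
    rw [inner_sum]
    refine Finset.sum_congr rfl fun j _ => ?_
    rw [real_inner_smul_left, real_inner_smul_right]; ring
  have h2 : ∑ i, ∑ j, l i * l j * ‖y i‖ ^ 2 = ∑ i, l i * ‖y i‖ ^ 2 := by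
    refine Finset.sum_congr rfl fun i _ => ?_
    calc ∑ j, l i * l j * ‖y i‖ ^ 2 = (∑ j, l j) * (l i * ‖y i‖ ^ 2) := by
          rw [Finset.sum_mul]; exact Finset.sum_congr rfl fun j _ => by ring
      _ = _ := by rw [hl, one_mul]
  have h3 : ∑ i, ∑ j, l i * l j * ‖y j‖ ^ 2 = ∑ i, l i * ‖y i‖ ^ 2 := by
    rw [Finset.sum_comm, ← h2]
    exact Finset.sum_congr rfl fun i _ => Finset.sum_congr rfl fun j _ => by ring
  calc ∑ i, ∑ j, l i * l j * ‖y i - y j‖ ^ 2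
      = ∑ i, ∑ j, l i * l j * ‖y i‖ ^ 2 + ∑ i, ∑ j, l i * l j * ‖y j‖ ^ 2
          - 2 * ∑ i, ∑ j, l i * l j * inner ℝ (y i) (y j) := by
        rw [Finset.mul_sum, ← Finset.sum_add_distrib, ← Finset.sum_sub_distrib]
        refine Finset.sum_congr rfl fun i _ => ?_
        rw [Finset.mul_sum, ← Finset.sum_add_distrib, ← Finset.sum_sub_distrib]
        refine Finset.sum_congr rfl fun j _ => ?_
        rw [norm_sub_sq_real]; ring
    _ = _ := by rw [h1, h2, h3]; ring

theorem exists_forall_norm_sub_le_of_fintype {ι : Type*} [Fintype ι] {x : ι → H₁} {y : ι → H₂}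
    (h : ∀ i j, ‖y i - y j‖ ≤ ‖x i - x j‖) (p : H₁) : ∃ q : H₂, ∀ i, ‖q - y i‖ ≤ ‖p - x i‖ := by
  classical
  rcases isEmpty_or_nonempty ι with _ | ⟨⟨i₀⟩⟩
  · exact ⟨0, isEmptyElim⟩
  set c : ι → ℝ := fun i => ‖y i‖ ^ 2 - ‖x i - p‖ ^ 2 with hc
  set Y : (ι → ℝ) → H₂ := fun l => ∑ i, l i • y i
  set G : (ι → ℝ) → ℝ := fun l => ∑ i, l i * c i - ‖Y l‖ ^ 2
  have hG : Continuous G := by fun_prop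
  obtain ⟨l, hl, hmax⟩ := (isCompact_stdSimplex ℝ ι).exists_isMaxOn
    ⟨_, single_mem_stdSimplex ℝ i₀⟩ hG.continuousOn
  have hGl : G l ≤ 0 := by
    have e1 := sum_mul_norm_sub_sq hl.2 y
    have e2 := sum_mul_norm_sub_sq hl.2 fun i => x i - p
    have e3 : ∑ i, ∑ j, l i * l j * ‖y i - y j‖ ^ 2 ≤
        ∑ i, ∑ j, l i * l j * ‖x i - p - (x j - p)‖ ^ 2 := by
      refine Finset.sum_le_sum fun i _ => Finset.sum_le_sum fun j _ => ?_
      have := mul_nonneg (hl.1 i) (hl.1 j)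
      rw [sub_sub_sub_cancel_right]
      gcongr
      exact h i j
    have e4 : G l = ∑ i, l i * ‖y i‖ ^ 2 - ∑ i, l i * ‖x i - p‖ ^ 2 - ‖∑ i, l i • y i‖ ^ 2 := by
      simp only [G, Y, hc, mul_sub, Finset.sum_sub_distrib]
    nlinarith [sq_nonneg ‖∑ i, l i • (x i - p)‖]
  refine ⟨Y l, fun j => ?_⟩
  set A : ℝ := c j - ∑ i, l i * c i - 2 * inner ℝ (Y l) (y j - Y l)
  set B : ℝ := ‖y j - Y l‖ ^ 2
  have hAB : ∀ t : ℝ, t ∈ Ioo (0 : ℝ) 1 → A ≤ t * B := by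
    intro t ht
    have hmem : (1 - t) • l + t • Pi.single j (1 : ℝ) ∈ stdSimplex ℝ ι :=
      convex_stdSimplex ℝ ι hl (single_mem_stdSimplex ℝ j) (by linarith [ht.2]) ht.1.le (by ring)
    have hle : G ((1 - t) • l + t • Pi.single j (1 : ℝ)) ≤ G l := hmax hmem
    have eY : Y ((1 - t) • l + t • Pi.single j (1 : ℝ)) = Y l + t • (y j - Y l) := by
      have : Y ((1 - t) • l + t • Pi.single j (1 : ℝ)) = (1 - t) • Y l + t • y j := by
        simp only [Y, Pi.add_apply, Pi.smul_apply, smul_eq_mul, add_smul, Finset.sum_add_distrib,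
          mul_smul, Finset.smul_sum, Pi.single_apply, ite_smul, one_smul, zero_smul, smul_ite,
          smul_zero, Finset.sum_ite_eq', Finset.mem_univ, if_true]
      rw [this]; module
    have ec : ∑ i, ((1 - t) • l + t • Pi.single j (1 : ℝ) : ι → ℝ) i * c i =
        (1 - t) * ∑ i, l i * c i + t * c j := by
      simp only [Pi.add_apply, Pi.smul_apply, smul_eq_mul, add_mul, Finset.sum_add_distrib,
        Finset.mul_sum, Pi.single_apply, mul_assoc]
      simp
    simp only [G, eY, ec] at hle
    rw [norm_add_sq_real, norm_smul, real_inner_smul_right, Real.norm_of_nonneg ht.1.le] at hle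
    have : t * A ≤ t * (t * B) := by simp only [A, B]; nlinarith
    exact le_of_mul_le_mul_left this ht.1
  have hA : A ≤ 0 := by
    have hlim : Tendsto (fun t : ℝ => t * B) (𝓝[>] 0) (𝓝 (0 * B)) :=
      (tendsto_id.mul_const B).mono_left nhdsWithin_le_nhds
    rw [zero_mul] at hlim
    exact ge_of_tendsto hlim (mem_of_superset (Ioo_mem_nhdsGT zero_lt_one) hAB)
  refine le_of_sq_le_sq ?_ (norm_nonneg _)
  have e5 : ‖Y l - y j‖ ^ 2 = ‖Y l‖ ^ 2 - 2 * inner ℝ (Y l) (y j) + ‖y j‖ ^ 2 :=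
    norm_sub_sq_real _ _
  have e6 : inner ℝ (Y l) (y j - Y l) = inner ℝ (Y l) (y j) - ‖Y l‖ ^ 2 := by
    rw [inner_sub_right, real_inner_self_eq_norm_sq]
  have e7 : ‖p - x j‖ = ‖x j - p‖ := norm_sub_rev _ _
  rw [e5, e7]
  simp only [A, G, e6, hc] at hA hGl
  linarith

variable [FiniteDimensional ℝ H₂]

theorem exists_forall_norm_sub_le {ι : Type*} {x : ι → H₁} {y : ι → H₂}
    (h : ∀ i j, ‖y i - y j‖ ≤ ‖x i - x j‖) (p : H₁) : ∃ q : H₂, ∀ i, ‖q - y i‖ ≤ ‖p - x i‖ := by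
  rcases isEmpty_or_nonempty ι with _ | ⟨⟨i₀⟩⟩
  · exact ⟨0, isEmptyElim⟩
  have := (isCompact_closedBall (y i₀) ‖p - x i₀‖).inter_iInter_nonempty
    (fun i => closedBall (y i) ‖p - x i‖) (fun i => isClosed_closedBall) fun u => by
      classical
      obtain ⟨q, hq⟩ := exists_forall_norm_sub_le_of_fintype
        (ι := ↥(insert i₀ u)) (x := fun i => x i) (y := fun i => y i) (fun i j => h i j) p
      refine ⟨q, ?_, mem_iInter₂.2 fun i hi => ?_⟩
      · simpa [dist_eq_norm] using hq ⟨i₀, Finset.mem_insert_self _ _⟩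
      · simpa [dist_eq_norm] using hq ⟨i, Finset.mem_insert_of_mem hi⟩
  obtain ⟨q, -, hq⟩ := this
  exact ⟨q, fun i => by simpa [dist_eq_norm] using mem_iInter.1 hq i⟩

/-- **Kirszbraun's theorem** for finite-dimensional targets. -/
theorem LipschitzOnWith.exists_extend_one {S : Set H₁} {f : H₁ → H₂} (hf : LipschitzOnWith 1 f S) :
    ∃ g : H₁ → H₂, LipschitzWith 1 g ∧ EqOn f g S := by
  set P : Set (Set (H₁ × H₂)) := {G | ∀ a ∈ G, ∀ b ∈ G, ‖a.2 - b.2‖ ≤ ‖a.1 - b.1‖}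
  obtain ⟨G, hfG, hG⟩ := zorn_subset_nonempty P (fun c hc hch _ => by
    refine ⟨⋃₀ c, ?_, fun s hs => subset_sUnion_of_mem hs⟩
    rintro a ⟨s, hs, has⟩ b ⟨t, ht, hbt⟩
    rcases hch.total hs ht with hst | hst
    · exact hc ht a (hst has) b hbt
    · exact hc hs a has b (hst hbt)) ((fun x => (x, f x)) '' S) (by
    rintro _ ⟨x, hx, rfl⟩ _ ⟨y, hy, rfl⟩
    simpa [dist_eq_norm] using hf.dist_le_mul x hx y hy)
  have key : ∀ x, ∃ y, (x, y) ∈ G := by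
    intro p
    obtain ⟨q, hq⟩ := exists_forall_norm_sub_le (ι := G) (x := fun a => a.1.1)
      (y := fun a => a.1.2) (fun a b => hG.prop a a.2 b b.2) p
    refine ⟨q, hG.le_of_ge (y := insert (p, q) G) ?_ (subset_insert _ _) (mem_insert _ _)⟩
    rintro a (rfl | ha) b (rfl | hb)
    · simp
    · exact hq ⟨b, hb⟩
    · rw [norm_sub_rev, norm_sub_rev a.1]; exact hq ⟨a, ha⟩
    · exact hG.prop a ha b hb
  choose g hg using key
  refine ⟨g, LipschitzWith.of_dist_le_mul fun x y => ?_, fun x hx => ?_⟩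
  · simpa [dist_eq_norm] using hG.prop _ (hg x) _ (hg y)
  · have := hG.prop _ (hfG ⟨x, hx, rfl⟩) _ (hg x)
    simpa [sub_eq_zero] using this

end Kirszbraun

/-- A sawtooth with slopes `±s` staying close to the linear function `t ↦ σ t`. -/
theorem exists_sawtooth {s σ a : ℝ} (hσ : |σ| ≤ s) (ha : 0 < a) :
    ∃ z : ℝ → ℝ, (∀ t t', |z t - z t'| ≤ s * |t - t'|) ∧ (∀ t, |z t - σ * t| ≤ a) ∧
      ∃ P : ℤ × Bool → Set ℝ, (∀ t, ∃ i, t ∈ P i) ∧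
        ∀ i, ∃ η : ℝ, |η| = s ∧ ∀ t ∈ P i, ∀ t' ∈ P i, z t - z t' = η * (t - t') := by
  have hs : 0 ≤ s := (abs_nonneg _).trans hσ
  obtain ⟨hσ1, hσ2⟩ := abs_le.1 hσ
  set l : ℝ := a / (2 * s + 1)
  have hl : 0 < l := by positivity
  have hla : 2 * s * l ≤ a := by
    have : l * (2 * s + 1) = a := div_mul_cancel₀ _ (by positivity)
    nlinarith
  set F : ℤ → ℝ → ℝ := fun p t => σ * (p * l) + s * |t - p * l| with hF
  have hfl : ∀ t : ℝ, ∃ q : ℤ, q * l ≤ t ∧ t ≤ (q + 1) * l := fun t =>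
    ⟨⌊t / l⌋, by rw [← le_div_iff₀ hl]; exact Int.floor_le _,
      by rw [← div_le_iff₀ hl]; exact (Int.lt_floor_add_one _).le⟩
  have hmin : ∀ t, ∃ p, ∀ p', F p t ≤ F p' t := by
    intro t
    obtain ⟨q, hq1, hq2⟩ := hfl t
    have h1 : ∀ p' ≤ q, F q t ≤ F p' t := by
      intro p' hp
      have hp' : (p' : ℝ) * l ≤ q * l := by
        have : (p' : ℝ) ≤ q := by exact_mod_cast hp
        gcongr
      simp only [hF]
      rw [abs_of_nonneg (by linarith), abs_of_nonneg (by linarith)]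
      nlinarith
    have h2 : ∀ p', q + 1 ≤ p' → F (q + 1) t ≤ F p' t := by
      intro p' hp
      have hp' : ((q : ℝ) + 1) * l ≤ p' * l := by
        have : ((q : ℝ) + 1) ≤ p' := by exact_mod_cast hp
        gcongr
      simp only [hF]
      push_cast
      rw [abs_of_nonpos (by linarith), abs_of_nonpos (by linarith)]
      nlinarith
    rcases le_total (F q t) (F (q + 1) t) with h | h
    · refine ⟨q, fun p' => ?_⟩
      rcases le_or_gt p' q with hp | hp
      · exact h1 p' hp
      · exact h.trans (h2 p' hp)
    · refine ⟨q + 1, fun p' => ?_⟩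
      rcases le_or_gt p' q with hp | hp
      · exact h.trans (h1 p' hp)
      · exact h2 p' hp
  choose p hp using hmin
  set z : ℝ → ℝ := fun t => F (p t) t with hz
  have hhalf : ∀ t t', z t - z t' ≤ s * |t - t'| := by
    intro t t'
    have h1 : z t ≤ F (p t') t := hp t _
    have h2 : |t - p t' * l| ≤ |t - t'| + |t' - p t' * l| := abs_sub_le _ _ _
    have h3 : F (p t') t - F (p t') t' ≤ s * |t - t'| := by simp only [hF]; nlinarith
    linarith
  have hlip : ∀ t t', |z t - z t'| ≤ s * |t - t'| := fun t t' =>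
    abs_sub_le_iff.2 ⟨hhalf t t', by rw [abs_sub_comm]; exact hhalf t' t⟩
  refine ⟨z, hlip, fun t => abs_le.2 ⟨?_, ?_⟩,
    fun i => {t | z t = F i.1 t ∧ if i.2 then i.1 * l ≤ t else t ≤ i.1 * l}, ?_, ?_⟩
  · have h1 : σ * (t - p t * l) ≤ s * |t - p t * l| :=
      (le_abs_self _).trans (by rw [abs_mul]; gcongr)
    simp only [hz, hF]
    nlinarith
  · obtain ⟨q, hq1, hq2⟩ := hfl t
    have h1 : z t ≤ F q t := hp t _
    have h2 : F q t = σ * (q * l) + s * (t - q * l) := by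
      simp only [hF]; rw [abs_of_nonneg (by linarith)]
    have h3 : (s - σ) * (t - q * l) ≤ (2 * s) * l := by
      apply mul_le_mul <;> linarith
    nlinarith
  · intro t
    rcases le_total (p t * l) t with h | h
    · exact ⟨(p t, true), rfl, by simpa using h⟩
    · exact ⟨(p t, false), rfl, by simpa using h⟩
  · rintro ⟨q, c⟩
    cases c
    · refine ⟨-s, by rw [abs_neg, abs_of_nonneg hs], ?_⟩
      rintro t ⟨ht, ht'⟩ u ⟨hu, hu'⟩
      simp only [Bool.false_eq_true, if_false] at ht' hu'
      simp only [ht, hu, hF]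
      rw [abs_of_nonpos (by linarith), abs_of_nonpos (by linarith)]; ring
    · refine ⟨s, abs_of_nonneg hs, ?_⟩
      rintro t ⟨ht, ht'⟩ u ⟨hu, hu'⟩
      simp only [if_true] at ht' hu'
      simp only [ht, hu, hF]
      rw [abs_of_nonneg (by linarith), abs_of_nonneg (by linarith)]; ring

theorem exists_singular_value_decomposition {V W : Type*} [NormedAddCommGroup V]
    [InnerProductSpace ℝ V] [FiniteDimensional ℝ V] [NormedAddCommGroup W] [InnerProductSpace ℝ W]
    [FiniteDimensional ℝ W] (hVW : Module.finrank ℝ V ≤ Module.finrank ℝ W) (T : V →ₗ[ℝ] W) {s : ℝ}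
    (hT : ∀ v, ‖T v‖ ≤ s * ‖v‖) :
    ∃ (b : OrthonormalBasis (Fin (Module.finrank ℝ V)) ℝ V) (w : Fin (Module.finrank ℝ V) → W)
      (σ : Fin (Module.finrank ℝ V) → ℝ), Orthonormal ℝ w ∧ (∀ i, |σ i| ≤ s) ∧
        ∀ v, T v = ∑ i, (σ i * inner ℝ (b i) v) • w i := by
  set d := Module.finrank ℝ V with hd
  have hsym : (LinearMap.adjoint T ∘ₗ T).IsSymmetric := fun x y => by
    simp [LinearMap.adjoint_inner_left, LinearMap.adjoint_inner_right]
  set b := hsym.eigenvectorBasis hd.symm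
  have horth : ∀ i j, i ≠ j → inner ℝ (T (b i)) (T (b j)) = (0 : ℝ) := by
    intro i j hij
    rw [← LinearMap.adjoint_inner_left]
    have := hsym.apply_eigenvectorBasis hd.symm i
    rw [LinearMap.comp_apply] at this
    rw [this, inner_smul_left, b.orthonormal.2 hij, mul_zero]
  set m := Module.finrank ℝ W
  set S : Set (Fin d ⊕ Fin (m - d)) := Sum.inl '' {i | T (b i) ≠ 0}
  set u : Fin d ⊕ Fin (m - d) → W := Sum.elim (fun i => ‖T (b i)‖⁻¹ • T (b i)) 0
  have hu : Orthonormal ℝ (S.domRestrict u) := by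
    constructor
    · rintro ⟨_, i, hi, rfl⟩
      exact norm_smul_inv_norm hi
    · rintro ⟨_, i, hi, rfl⟩ ⟨_, j, hj, rfl⟩ hij
      have : i ≠ j := fun h => hij (by subst h; rfl)
      simp [u, Set.domRestrict, real_inner_smul_left, real_inner_smul_right, horth i j this]
  obtain ⟨w, hw⟩ := hu.exists_orthonormalBasis_extension_of_card_eq (by simp; omega)
  refine ⟨b, fun i => w (Sum.inl i), fun i => ‖T (b i)‖, w.orthonormal.comp _ Sum.inl_injective,
    fun i => ?_, fun v => ?_⟩
  · rw [abs_norm]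
    simpa [b.orthonormal.1 i] using hT (b i)
  · conv_lhs => rw [← b.sum_repr' v, map_sum]
    refine Finset.sum_congr rfl fun i _ => ?_
    rw [map_smul]
    by_cases hi : T (b i) = 0
    · simp [hi]
    · simp only [hw (Sum.inl i) ⟨i, hi, rfl⟩, u, Sum.elim_inl, smul_smul]
      congr 1
      field_simp [norm_ne_zero_iff.2 hi]

theorem Orthonormal.norm_sq_sum_smul {W ι : Type*} [NormedAddCommGroup W] [InnerProductSpace ℝ W]
    [Fintype ι] {w : ι → W} (hw : Orthonormal ℝ w) (l : ι → ℝ) :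
    ‖∑ i, l i • w i‖ ^ 2 = ∑ i, l i ^ 2 := by
  rw [← real_inner_self_eq_norm_sq, hw.inner_sum]
  exact Finset.sum_congr rfl fun i _ => by simp [sq]

/-- A piecewise linear map which is uniformly close to a linear extension of `C ∘ A⁻¹`
and which on each of countably many pieces is `s` times an isometry on the range of `A`. -/
theorem exists_zigzag {X Y W : Type*} [NormedAddCommGroup X] [NormedSpace ℝ X]
    [FiniteDimensional ℝ X] [NormedAddCommGroup Y] [InnerProductSpace ℝ Y]
    [NormedAddCommGroup W] [InnerProductSpace ℝ W] [FiniteDimensional ℝ W]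
    (hXW : Module.finrank ℝ X ≤ Module.finrank ℝ W) (A : X →L[ℝ] Y) (C : X →L[ℝ] W) {s : ℝ}
    (hs : 0 ≤ s) (hAC : ∀ x, ‖C x‖ ≤ s * ‖A x‖) {a : ℝ} (ha : 0 < a) :
    ∃ (Γ : Y →L[ℝ] W) (Z : Y → W), (∀ x, Γ (A x) = C x) ∧ (∀ p, ‖Γ p‖ ≤ s * ‖p‖) ∧
      (∀ p q, ‖Z p - Z q‖ ≤ s * ‖p - q‖) ∧ (∀ p, ‖Z p - Γ p‖ ≤ a) ∧
      ∃ Q : (Fin (Module.finrank ℝ A.range) → ℤ × Bool) → Set Y,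
        (∀ p, ∃ i, p ∈ Q i) ∧ ∀ i, ∃ L : Y →L[ℝ] W, (∀ x, ‖L (A x)‖ = s * ‖A x‖) ∧
          (∀ p, ‖L p‖ ≤ s * ‖p‖) ∧ ∀ p ∈ Q i, ∀ q ∈ Q i, Z p - Z q = L (p - q) := by
  set d := Module.finrank ℝ A.range with hd
  obtain ⟨g, hg⟩ := (A : X →ₗ[ℝ] Y).rangeRestrict.exists_rightInverse_of_surjective
    (LinearMap.range_rangeRestrict _)
  have hg' : ∀ v : A.range, A (g v) = v := fun v =>
    congrArg Subtype.val (LinearMap.congr_fun hg v)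
  have hgA : ∀ x (hx : A x ∈ A.range), C (g ⟨A x, hx⟩) = C x := fun x hx => by
    have := hAC (g ⟨A x, hx⟩ - x)
    rw [map_sub A, hg', sub_self, norm_zero, mul_zero, map_sub] at this
    exact sub_eq_zero.1 (norm_le_zero_iff.1 this)
  obtain ⟨b', w, σ, hw, hσ, hT⟩ := exists_singular_value_decomposition
    ((LinearMap.finrank_range_le (A : X →ₗ[ℝ] Y)).trans hXW) ((C : X →ₗ[ℝ] W) ∘ₗ g) (s := s)
    (fun v => by simpa [hg'] using hAC (g v))
  set b : Fin d → Y := fun i => b' i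
  have hb : Orthonormal ℝ b := b'.orthonormal.comp_linearIsometry A.range.subtypeₗᵢ
  have hbA : ∀ x, ∑ i, inner ℝ (b i) (A x) ^ 2 = ‖A x‖ ^ 2 := fun x => by
    have := b'.sum_sq_norm_inner_right ⟨A x, x, rfl⟩
    simpa [b] using this
  have hbess : ∀ p, ∑ i, inner ℝ (b i) p ^ 2 ≤ ‖p‖ ^ 2 := fun p => by
    simpa using hb.sum_inner_products_le (s := Finset.univ) p
  have hle : ∀ (c : Fin d → ℝ) (p : Y), (∀ i, |c i| ≤ s * |inner ℝ (b i) p|) →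
      ‖∑ i, c i • w i‖ ≤ s * ‖p‖ := fun c p hc => by
    refine le_of_sq_le_sq ?_ (by positivity)
    rw [hw.norm_sq_sum_smul, mul_pow]
    calc ∑ i, c i ^ 2 ≤ ∑ i, s ^ 2 * inner ℝ (b i) p ^ 2 := by
          refine Finset.sum_le_sum fun i _ => ?_
          rw [← sq_abs (c i), ← sq_abs (inner ℝ (b i) p), ← mul_pow]
          gcongr
          exact hc i
      _ ≤ _ := by rw [← Finset.mul_sum]; gcongr; exact hbess p
  have hlin : ∀ c : Fin d → ℝ, ∃ L : Y →L[ℝ] W,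
      ∀ p, L p = ∑ i, (c i * inner ℝ (b i) p) • w i := fun c =>
    ⟨∑ i, c i • (innerSL ℝ (b i)).smulRight (w i), fun p => by
      simp [smul_smul]⟩
  obtain ⟨Γ, hΓ⟩ := hlin σ
  have ha' : 0 < a / (d + 1) := by positivity
  choose z hz1 hz2 P hP2 η hη1 hη2 using fun i => exists_sawtooth (hσ i) ha'
  refine ⟨Γ, fun p => ∑ i, z i (inner ℝ (b i) p) • w i, fun x => ?_, fun p => ?_, fun p q => ?_,
    fun p => ?_, fun f => ⋂ i, {p | inner ℝ (b i) p ∈ P i (f i)}, fun p => ?_,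
    fun f => ?_⟩
  · rw [hΓ, ← hgA x ⟨x, rfl⟩]
    exact (hT ⟨A x, x, rfl⟩).symm
  · rw [hΓ]
    exact hle _ _ fun i => by rw [abs_mul]; gcongr; exact hσ i
  · rw [← Finset.sum_sub_distrib]
    simp only [← sub_smul]
    exact hle _ _ fun i => by rw [inner_sub_right]; exact hz1 i _ _
  · rw [hΓ, ← Finset.sum_sub_distrib]
    simp only [← sub_smul]
    calc _ ≤ ∑ i : Fin d, a / (d + 1) := by
          refine norm_sum_le_of_le _ fun i _ => ?_
          rw [norm_smul, hw.1 i, mul_one]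
          exact hz2 i _
      _ = d * (a / (d + 1)) := by simp
      _ ≤ a := by
          rw [mul_div_assoc', div_le_iff₀ (by positivity)]
          nlinarith
  · choose f hf using fun i => hP2 i (inner ℝ (b i) p)
    exact ⟨f, mem_iInter.2 hf⟩
  · obtain ⟨L, hL⟩ := hlin fun i => η i (f i)
    refine ⟨L, fun x => ?_, fun p => ?_, fun p hp q hq => ?_⟩
    · refine (sq_eq_sq₀ (norm_nonneg _) (by positivity)).1 ?_
      rw [hL, hw.norm_sq_sum_smul, mul_pow, ← hbA, Finset.mul_sum]
      refine Finset.sum_congr rfl fun i _ => ?_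
      rw [mul_pow, ← sq_abs (η i (f i)), hη1]
    · rw [hL]
      exact hle _ _ fun i => by rw [abs_mul, hη1]
    · rw [hL, ← Finset.sum_sub_distrib]
      refine Finset.sum_congr rfl fun i _ => ?_
      rw [← sub_smul, hη2 i (f i) _ (mem_iInter.1 hp i) _ (mem_iInter.1 hq i), inner_sub_right]

theorem exists_pos_forall_le_dist_of_pairwise_disjoint {Y ι : Type*} [MetricSpace Y] [Finite ι]
    {K : ι → Set Y} (hK : ∀ i, IsCompact (K i)) (hd : Pairwise (Function.onFun Disjoint K)) :
    ∃ τ > 0, ∀ i j, i ≠ j → ∀ p ∈ K i, ∀ q ∈ K j, τ ≤ dist p q := by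
  have : ∀ᶠ τ in 𝓝[>] (0 : ℝ), ∀ i j, i ≠ j → ∀ p ∈ K i, ∀ q ∈ K j, τ ≤ dist p q := by
    refine eventually_all.2 fun i => eventually_all.2 fun j => ?_
    by_cases hij : i = j
    · simp [hij]
    obtain ⟨r, hr, h⟩ := exists_pos_forall_lt_edist (hK i) (hK j).isClosed (hd hij)
    filter_upwards [Ioo_mem_nhdsGT (show (0 : ℝ) < r from hr)] with τ hτ _ p hp q hq
    have := h p hp q hq
    rw [edist_nndist, ENNReal.coe_lt_coe, ← NNReal.coe_lt_coe, coe_nndist] at this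
    linarith [hτ.2]
  obtain ⟨τ, h1, h2⟩ := (this.and self_mem_nhdsWithin).exists
  exact ⟨τ, h2, h1⟩

/-- Small perturbations of a strictly contracting map on disjoint compact sets can be glued. -/
theorem exists_lipschitzWith_one_glue {Y W ι : Type*} [NormedAddCommGroup Y]
    [InnerProductSpace ℝ Y] [NormedAddCommGroup W] [InnerProductSpace ℝ W] [FiniteDimensional ℝ W]
    [Finite ι] {K : ι → Set Y} (hK : ∀ i, IsCompact (K i))
    (hd : Pairwise (Function.onFun Disjoint K)) {f : Y → W} {ε : ℝ} (hε0 : 0 < ε)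
    (hf : ∀ p q, ‖f p - f q‖ ≤ (1 - ε) * ‖p - q‖) {ρ : ℝ} (hρ : 0 < ρ) :
    ∃ a > 0, ∀ u : ι → Y → W,
      (∀ i, ∀ p ∈ K i, ∀ q ∈ K i, ‖u i p - u i q‖ ≤ ‖p - q‖) →
      (∀ i, ∀ p ∈ K i, ‖u i p - f p‖ ≤ a) →
      ∃ g : Y → W, LipschitzWith 1 g ∧ (∀ i, EqOn g (u i) (K i)) ∧ ∀ p, ‖g p - f p‖ ≤ ρ := by
  obtain ⟨τ, hτ, hsep⟩ := exists_pos_forall_le_dist_of_pairwise_disjoint hK hd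
  set ρ' := ρ / 4 with hρ'
  have hρ'0 : 0 < ρ' := by positivity
  refine ⟨min (ε * τ / 2) (min (ε * ρ') (ρ / 2)), by positivity, fun u hu hua => ?_⟩
  set a := min (ε * τ / 2) (min (ε * ρ') (ρ / 2))
  have ha1 : a ≤ ε * τ / 2 := min_le_left _ _
  have ha2 : a ≤ ε * ρ' := (min_le_right _ _).trans (min_le_left _ _)
  have ha3 : a ≤ ρ / 2 := (min_le_right _ _).trans (min_le_right _ _)
  set S : Set Y := {p | (∃ i, p ∈ K i) ∨ ∀ i, ∀ q ∈ K i, ρ' ≤ ‖p - q‖}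
  have hex : ∃ w : Y → W, (∀ i, ∀ p ∈ K i, w p = u i p) ∧ ∀ p, (∀ i, p ∉ K i) → w p = f p := by
    classical
    refine ⟨fun p => if h : ∃ i, p ∈ K i then u h.choose p else f p, fun i p hp => ?_,
      fun p hp => by simp [hp]⟩
    have h : ∃ i, p ∈ K i := ⟨i, hp⟩
    have : h.choose = i := by
      by_contra hne
      exact disjoint_left.1 (hd hne) h.choose_spec hp
    simp only [dif_pos h, this]
  obtain ⟨w, hwK, hwf⟩ := hex
  have hone : ∀ i, ∀ p ∈ K i, ∀ q, (∀ j, q ∉ K j) → (∀ j, ∀ q' ∈ K j, ρ' ≤ ‖q - q'‖) →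
      ‖w p - w q‖ ≤ ‖p - q‖ := by
    intro i p hp q hq hqS
    rw [hwK i p hp, hwf q hq]
    have h1 := hqS i p hp
    rw [norm_sub_rev] at h1
    calc ‖u i p - f q‖ = ‖(u i p - f p) + (f p - f q)‖ := by congr 1; abel
      _ ≤ a + (1 - ε) * ‖p - q‖ := (norm_add_le _ _).trans (add_le_add (hua i p hp) (hf p q))
      _ ≤ ‖p - q‖ := by nlinarith
  have hwS : LipschitzOnWith 1 w S := by
    refine LipschitzOnWith.of_dist_le_mul fun p hp q hq => ?_
    rw [NNReal.coe_one, one_mul, dist_eq_norm, dist_eq_norm]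
    by_cases hp' : ∃ i, p ∈ K i
    · obtain ⟨i, hi⟩ := hp'
      by_cases hq' : ∃ i, q ∈ K i
      · obtain ⟨j, hj⟩ := hq'
        by_cases hij : i = j
        · subst hij
          rw [hwK i p hi, hwK i q hj]
          exact hu i p hi q hj
        · rw [hwK i p hi, hwK j q hj]
          have h1 := hsep i j hij p hi q hj
          rw [dist_eq_norm] at h1
          have h2 := hua j q hj
          rw [norm_sub_rev] at h2
          calc ‖u i p - u j q‖ = ‖(u i p - f p) + (f p - f q) + (f q - u j q)‖ := by
                congr 1; abel
            _ ≤ a + (1 - ε) * ‖p - q‖ + a := norm_add₃_le.trans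
                (add_le_add (add_le_add (hua i p hi) (hf p q)) h2)
            _ ≤ ‖p - q‖ := by nlinarith
      · exact hone i p hi q (not_exists.1 hq') (hq.resolve_left hq')
    · by_cases hq' : ∃ i, q ∈ K i
      · obtain ⟨j, hj⟩ := hq'
        rw [norm_sub_rev, norm_sub_rev p]
        exact hone j q hj p (not_exists.1 hp') (hp.resolve_left hp')
      · rw [hwf p (not_exists.1 hp'), hwf q (not_exists.1 hq')]
        exact (hf p q).trans (by nlinarith [norm_nonneg (p - q)])
  obtain ⟨g, hg, hgw⟩ := hwS.exists_extend_one
  have hgK : ∀ i, EqOn g (u i) (K i) := fun i p hp => by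
    rw [← hgw (Or.inl ⟨i, hp⟩), hwK i p hp]
  refine ⟨g, hg, hgK, fun p => ?_⟩
  by_cases hp : ∀ i, ∀ q ∈ K i, ρ' ≤ ‖p - q‖
  · have hpK : ∀ i, p ∉ K i := fun i hi => by
      have := hp i p hi
      rw [sub_self, norm_zero] at this
      linarith
    rw [← hgw (Or.inr hp), hwf p hpK, sub_self, norm_zero]
    exact hρ.le
  · push Not at hp
    obtain ⟨i, q, hq, hpq⟩ := hp
    have h1 : ‖g p - g q‖ ≤ ‖p - q‖ := by simpa [dist_eq_norm] using hg.dist_le_mul p q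
    have h2 : ‖g q - f q‖ ≤ a := by rw [hgK i hq]; exact hua i q hq
    have h3 : ‖f q - f p‖ ≤ ‖p - q‖ := by
      rw [norm_sub_rev]
      exact (hf p q).trans (by nlinarith [norm_nonneg (p - q)])
    calc ‖g p - f p‖ = ‖(g p - g q) + (g q - f q) + (f q - f p)‖ := by congr 1; abel
      _ ≤ ‖p - q‖ + a + ‖p - q‖ := norm_add₃_le.trans (add_le_add (add_le_add h1 h2) h3)
      _ ≤ ρ := by rw [hρ'] at hpq; linarith

theorem exists_near_isometric_perturbation {X Y W : Type*} [NormedAddCommGroup X]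
    [NormedSpace ℝ X] [FiniteDimensional ℝ X] [NormedAddCommGroup Y] [InnerProductSpace ℝ Y]
    [NormedAddCommGroup W] [InnerProductSpace ℝ W] [FiniteDimensional ℝ W]
    (hXW : Module.finrank ℝ X ≤ Module.finrank ℝ W) {F : Set X} {φ : X → Y} {f : Y → W}
    (A : X →L[ℝ] Y) (C : X →L[ℝ] W) {ε κ r : ℝ} (hε0 : 0 < ε) (hε1 : ε < 1) (hr : 0 ≤ r)
    (hκ : ∀ z, κ * ‖z‖ ≤ ‖A z‖) (hrκ : 3 * r ≤ ε * κ) (hrε : 4 * r ≤ ε)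
    (hAC : ∀ z, ‖C z‖ ≤ (1 - ε) * ‖A z‖)
    (hφ : ∀ x ∈ F, ∀ y ∈ F, ‖φ x - φ y - A (x - y)‖ ≤ r * ‖x - y‖)
    (hf : ∀ x ∈ F, ∀ y ∈ F, ‖f (φ x) - f (φ y) - C (x - y)‖ ≤ r * ‖x - y‖)
    {a : ℝ} (ha : 0 < a) :
    ∃ u : Y → W, (∀ p, ‖u p - f p‖ ≤ a) ∧
      (∀ x ∈ F, ∀ y ∈ F, ‖u (φ x) - u (φ y)‖ ≤ ‖φ x - φ y‖) ∧
      ∃ Q : (Fin (Module.finrank ℝ A.range) → ℤ × Bool) → Set X, (∀ x, ∃ i, x ∈ Q i) ∧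
        ∀ i, ∀ x ∈ F ∩ Q i, ∀ y ∈ F ∩ Q i,
          (1 - ε) * ‖φ x - φ y‖ ≤ ‖u (φ x) - u (φ y)‖ + ε * ‖x - y‖ := by
  obtain ⟨Γ, Z, hΓA, hΓ, hZ, hZΓ, Q, hQ, hQL⟩ :=
    exists_zigzag hXW A C (by linarith : 0 ≤ 1 - ε) hAC ha
  have hdiff : ∀ x ∈ F, ∀ y ∈ F,
      ‖f (φ x) + (Z (φ x) - Γ (φ x)) - (f (φ y) + (Z (φ y) - Γ (φ y))) - (Z (φ x) - Z (φ y))‖ ≤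
        2 * r * ‖x - y‖ := by
    intro x hx y hy
    have h1 : f (φ x) + (Z (φ x) - Γ (φ x)) - (f (φ y) + (Z (φ y) - Γ (φ y))) -
        (Z (φ x) - Z (φ y)) =
        (f (φ x) - f (φ y) - C (x - y)) - Γ (φ x - φ y - A (x - y)) := by
      rw [map_sub Γ, map_sub Γ, hΓA]; abel
    have h2 : ‖Γ (φ x - φ y - A (x - y))‖ ≤ r * ‖x - y‖ := by
      refine (hΓ _).trans ?_
      have := hφ x hx y hy
      nlinarith [norm_nonneg (φ x - φ y - A (x - y))]
    rw [h1]
    refine (norm_sub_le _ _).trans ?_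
    linarith [hf x hx y hy]
  refine ⟨fun p => f p + (Z p - Γ p), fun p => by simpa using hZΓ p, fun x hx y hy => ?_,
    fun i => φ ⁻¹' Q i, fun x => hQ (φ x), fun i => ?_⟩
  · have h1 := norm_le_norm_add_norm_sub' (f (φ x) + (Z (φ x) - Γ (φ x)) -
      (f (φ y) + (Z (φ y) - Γ (φ y)))) (Z (φ x) - Z (φ y))
    have h2 := norm_le_norm_add_norm_sub' (A (x - y)) (φ x - φ y)
    have h3 := hφ x hx y hy
    rw [norm_sub_rev] at h3
    have h4 := hκ (x - y)
    have h5 := hZ (φ x) (φ y)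
    have h6 := hdiff x hx y hy
    have h7 : 2 * r * ‖x - y‖ ≤ ε * ‖φ x - φ y‖ := by
      have : (κ - r) * ‖x - y‖ ≤ ‖φ x - φ y‖ := by linarith
      calc 2 * r * ‖x - y‖ ≤ ε * (κ - r) * ‖x - y‖ := by
            refine mul_le_mul_of_nonneg_right ?_ (norm_nonneg _)
            nlinarith
        _ ≤ _ := by rw [mul_assoc]; gcongr
    linarith
  · rintro x ⟨hx, hxQ⟩ y ⟨hy, hyQ⟩
    obtain ⟨L, hLA, hL, hLZ⟩ := hQL i
    have h1 := hdiff x hx y hy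
    have h2 := hLZ _ hxQ _ hyQ
    have h3 : (1 - ε) * ‖φ x - φ y‖ ≤ ‖L (φ x - φ y)‖ + 2 * r * ‖x - y‖ := by
      have e1 := norm_le_norm_add_norm_sub' (φ x - φ y) (A (x - y))
      have e2 := norm_le_norm_add_norm_sub' (L (A (x - y))) (L (φ x - φ y))
      rw [← map_sub L, hLA] at e2
      have e3 := hL (A (x - y) - (φ x - φ y))
      rw [norm_sub_rev _ (φ x - φ y)] at e3
      have e4 := hφ x hx y hy
      nlinarith [norm_nonneg (φ x - φ y - A (x - y)), norm_nonneg (x - y)]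
    have h4 := norm_le_norm_add_norm_sub (f (φ x) + (Z (φ x) - Γ (φ x)) -
      (f (φ y) + (Z (φ y) - Γ (φ y)))) (Z (φ x) - Z (φ y))
    rw [h2] at h4 h1
    have h5 : 4 * r * ‖x - y‖ ≤ ε * ‖x - y‖ := by gcongr
    linarith

theorem exists_measurableSet_subset_forall_of_ae {X : Type*} [MeasurableSpace X] {μ : Measure X}
    {T : Set X} (hT : MeasurableSet T) {P : X → Prop} (h : ∀ᵐ x ∂μ.restrict T, P x) :
    ∃ T₀ ⊆ T, MeasurableSet T₀ ∧ μ (T \ T₀) = 0 ∧ ∀ x ∈ T₀, P x := by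
  rw [ae_restrict_iff' hT] at h
  refine ⟨T \ toMeasurable μ {x | ¬ (x ∈ T → P x)}, sdiff_subset,
    hT.diff (measurableSet_toMeasurable _ _), ?_, fun x hx => ?_⟩
  · rw [sdiff_sdiff_right_self]
    refine measure_mono_null inter_subset_right ?_
    rw [measure_toMeasurable]
    exact ae_iff.1 h
  · by_contra hP
    exact hx.2 (subset_toMeasurable _ _ fun h => hP (h hx.1))

theorem exists_finite_compact_family {X : Type*} [TopologicalSpace X] [MeasurableSpace X]
    [T2Space X] [OpensMeasurableSpace X] {μ : Measure X} [μ.InnerRegularCompactLTTop] {T : Set X}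
    (hT : MeasurableSet T)
    (hμT : μ T ≠ ∞) {t : ℕ → Set X} (ht : ∀ j, MeasurableSet (t j)) (hTt : T ⊆ ⋃ j, t j)
    {η : ℝ≥0∞} (hη : η ≠ 0) :
    ∃ (N : ℕ) (F : ℕ → Set X), (∀ j, F j ⊆ T ∩ t j) ∧ (∀ j, IsCompact (F j)) ∧
      μ (T \ ⋃ j : Fin N, F j) ≤ η := by
  have hη2 : η / 2 ≠ 0 := by simpa using hη
  obtain ⟨δ, hδ, hδs⟩ := ENNReal.exists_pos_sum_of_countable' hη2 ℕ
  have : ∀ j, ∃ F ⊆ T ∩ t j, IsCompact F ∧ μ ((T ∩ t j) \ F) < δ j := fun j =>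
    (hT.inter (ht j)).exists_isCompact_sdiff_lt
      ((measure_mono inter_subset_left).trans_lt hμT.lt_top).ne (hδ j).ne'
  choose F hFs hFc hFμ using this
  have hFm : ∀ j, MeasurableSet (F j) := fun j => (hFc j).measurableSet
  have hall : μ (T \ ⋃ j, F j) ≤ η / 2 := by
    calc μ (T \ ⋃ j, F j) ≤ μ (⋃ j, (T ∩ t j) \ F j) := by
          refine measure_mono fun x hx => ?_
          obtain ⟨j, hj⟩ := mem_iUnion.1 (hTt hx.1)
          exact mem_iUnion.2 ⟨j, ⟨hx.1, hj⟩, fun h => hx.2 (mem_iUnion.2 ⟨j, h⟩)⟩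
      _ ≤ ∑' j, μ ((T ∩ t j) \ F j) := measure_iUnion_le _
      _ ≤ ∑' j, δ j := ENNReal.tsum_le_tsum fun j => (hFμ j).le
      _ ≤ η / 2 := hδs.le
  have hlim : Tendsto (fun N : ℕ => μ (T \ ⋃ j : Fin N, F j)) atTop
      (𝓝 (μ (⋂ N : ℕ, T \ ⋃ j : Fin N, F j))) := by
    refine tendsto_measure_iInter_atTop
      (fun N => (hT.diff (MeasurableSet.iUnion fun j => hFm _)).nullMeasurableSet) ?_
      ⟨0, ((measure_mono sdiff_subset).trans_lt hμT.lt_top).ne⟩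
    intro M N hMN
    refine sdiff_subset_sdiff_right (iUnion_subset fun j => ?_)
    exact subset_iUnion (fun j : Fin N => F j) (j.castLE hMN)
  have hint : ⋂ N : ℕ, T \ ⋃ j : Fin N, F j = T \ ⋃ j, F j := by
    rw [← sdiff_iUnion]
    congr 1
    ext x
    simp only [mem_iUnion]
    exact ⟨fun ⟨_, j, h⟩ => ⟨j, h⟩, fun ⟨j, h⟩ => ⟨j + 1, Fin.last j, h⟩⟩
  rw [hint] at hlim
  by_cases hη' : η = ∞
  · exact ⟨0, F, hFs, hFc, hη' ▸ le_top⟩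
  obtain ⟨N, hN⟩ := (hlim.eventually_lt_const
    (hall.trans_lt (ENNReal.half_lt_self hη hη'))).exists
  exact ⟨N, F, hFs, hFc, hN.le⟩

theorem ContinuousLinearMap.exists_pos_mul_norm_le {X Y : Type*} [NormedAddCommGroup X]
    [NormedSpace ℝ X] [FiniteDimensional ℝ X] [NormedAddCommGroup Y] [NormedSpace ℝ Y]
    (A : X →L[ℝ] Y) (hA : ∀ v, A v = 0 → v = 0) : ∃ κ > 0, ∀ z, κ * ‖z‖ ≤ ‖A z‖ := by
  obtain ⟨K, hK, h⟩ := (A : X →ₗ[ℝ] Y).exists_antilipschitzWith (LinearMap.ker_eq_bot'.2 hA)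
  have hK' : (0 : ℝ) < K := hK
  refine ⟨(K : ℝ)⁻¹, by positivity, fun z => ?_⟩
  have := h.le_mul_dist z 0
  simp only [dist_zero_right, map_zero] at this
  rw [inv_mul_le_iff₀ hK']
  exact this

theorem exists_near_isometric {X Y W : Type*} [NormedAddCommGroup X] [NormedSpace ℝ X]
    [FiniteDimensional ℝ X] [MeasurableSpace X] [BorelSpace X] {μ : Measure X} [μ.IsAddHaarMeasure]
    [NormedAddCommGroup Y] [InnerProductSpace ℝ Y] [FiniteDimensional ℝ Y]
    [NormedAddCommGroup W] [InnerProductSpace ℝ W] [FiniteDimensional ℝ W]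
    (hXW : Module.finrank ℝ X ≤ Module.finrank ℝ W) {T : Set X} (hT : MeasurableSet T)
    (hμT : μ T ≠ ∞) {φ : X → Y} {Kφ : NNReal} (hφ : LipschitzWith Kφ φ) (hinj : InjOn φ T)
    (hder : ∀ x ∈ T, ∀ v, fderiv ℝ φ x v = 0 → v = 0) {f : Y → W} (hf : LipschitzWith 1 f)
    {ε ρ : ℝ} (hε0 : 0 < ε) (hε1 : ε < 1) (hρ : 0 < ρ) {η : ℝ≥0∞} (hη : η ≠ 0) :
    ∃ g : Y → W, LipschitzWith 1 g ∧ (∀ p, ‖g p - (1 - ε) • f p‖ ≤ ρ) ∧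
      ∃ T' ⊆ T, MeasurableSet T' ∧ μ (T \ T') ≤ η ∧ ∀ᵐ x ∂μ.restrict T',
        ∀ v, (1 - ε) * ‖fderiv ℝ φ x v‖ ≤ ‖fderiv ℝ (g ∘ φ) x v‖ + ε * ‖v‖ := by
  have hs : 0 ≤ 1 - ε := by linarith
  set f₁ : Y → W := fun p => (1 - ε) • f p with hf₁
  have hf₁d : ∀ p q, ‖f₁ p - f₁ q‖ ≤ (1 - ε) * ‖p - q‖ := fun p q => by
    rw [hf₁, ← smul_sub, norm_smul, Real.norm_of_nonneg hs]
    gcongr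
    simpa [dist_eq_norm] using hf.dist_le_mul p q
  have hf₁L : LipschitzWith 1 f₁ := LipschitzWith.of_dist_le_mul fun p q => by
    rw [dist_eq_norm, dist_eq_norm, NNReal.coe_one]
    refine (hf₁d p q).trans ?_
    gcongr
    linarith
  have hgood : ∀ᵐ x ∂μ.restrict T, DifferentiableAt ℝ φ x ∧ DifferentiableAt ℝ (f₁ ∘ φ) x ∧
      ∀ v, ‖fderiv ℝ (f₁ ∘ φ) x v‖ ≤ (1 - ε) * ‖fderiv ℝ φ x v‖ := by
    filter_upwards [ae_fullTangent μ T, ae_restrict_of_ae hφ.ae_differentiableAt,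
      ae_restrict_of_ae (hf₁L.comp hφ).ae_differentiableAt] with x hx h1 h2
    refine ⟨h1, h2, fun v => ?_⟩
    have := hx.norm_fderiv_le (c := 0) h2.hasFDerivAt (h1.hasFDerivAt.const_smul (1 - ε))
      (fun y _ => by
        rw [zero_mul, add_zero, Pi.smul_apply, Pi.smul_apply, ← smul_sub, norm_smul,
          Real.norm_of_nonneg hs]
        exact hf₁d _ _) v
    simpa [norm_smul, Real.norm_of_nonneg hs] using this
  obtain ⟨T₀, hT₀T, hT₀, hμT₀, hT₀P⟩ := exists_measurableSet_subset_forall_of_ae hT hgood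
  rcases T₀.eq_empty_or_nonempty with rfl | hne
  · exact ⟨f₁, hf₁L, fun p => by simpa [hf₁] using hρ.le, ∅, empty_subset _, MeasurableSet.empty,
      hμT₀.le.trans zero_le, by simp⟩
  have hr : ∀ B : X →L[ℝ] Y × W, ∃ (r : NNReal) (κ : ℝ), r ≠ 0 ∧ ((∀ v, (B v).1 = 0 → v = 0) →
      (∀ z, κ * ‖z‖ ≤ ‖(B z).1‖) ∧ 3 * (r : ℝ) ≤ ε * κ ∧ 4 * (r : ℝ) ≤ ε) := by
    intro B
    by_cases hB : ∀ v, (B v).1 = 0 → v = 0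
    · obtain ⟨κ, hκ, h⟩ := ((ContinuousLinearMap.fst ℝ Y W).comp B).exists_pos_mul_norm_le hB
      have h0 : 0 < min (ε * κ / 3) (ε / 4) := by positivity
      refine ⟨Real.toNNReal (min (ε * κ / 3) (ε / 4)), κ, by simpa using h0, fun _ => ⟨h, ?_, ?_⟩⟩
      · rw [Real.coe_toNNReal _ h0.le]
        linarith [min_le_left (ε * κ / 3) (ε / 4)]
      · rw [Real.coe_toNNReal _ h0.le]
        linarith [min_le_right (ε * κ / 3) (ε / 4)]
    · exact ⟨1, 0, one_ne_zero, fun h => absurd h hB⟩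
  choose r κ hr0 hrκ using hr
  obtain ⟨t, B, htd, htm, hcov, happ, hB⟩ :=
    exists_partition_approximatesLinearOn_of_hasFDerivWithinAt (fun x => (φ x, f₁ (φ x))) T₀
      (fun x => (fderiv ℝ φ x).prod (fderiv ℝ (f₁ ∘ φ) x))
      (fun x hx => ((hT₀P x hx).1.hasFDerivAt.prodMk
        (hT₀P x hx).2.1.hasFDerivAt).hasFDerivWithinAt) r hr0
  obtain ⟨N, F, hFt, hFc, hFμ⟩ := exists_finite_compact_family (μ := μ) hT₀
    ((measure_mono hT₀T).trans_lt hμT.lt_top).ne htm hcov hη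
  have hFT₀ : ∀ j, F j ⊆ T₀ := fun j => (hFt j).trans inter_subset_left
  have hKd : Pairwise (Function.onFun Disjoint fun j : Fin N => φ '' F j) := by
    intro i j hij
    refine disjoint_left.2 ?_
    rintro _ ⟨x, hx, rfl⟩ ⟨y, hy, hyx⟩
    have := hinj (hT₀T (hFT₀ _ hy)) (hT₀T (hFT₀ _ hx)) hyx
    exact disjoint_left.1 (htd (Fin.val_ne_of_ne hij)) (hFt _ hx).2 (this ▸ (hFt _ hy).2)
  obtain ⟨a, ha, hglue⟩ := exists_lipschitzWith_one_glue (f := f₁) (ε := ε) (ρ := ρ)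
    (fun j : Fin N => (hFc j).image hφ.continuous) hKd hε0 hf₁d hρ
  have happ' : ∀ j, ∀ x ∈ F j, ∀ y ∈ F j,
      ‖(φ x, f₁ (φ x)) - (φ y, f₁ (φ y)) - B j (x - y)‖ ≤ r (B j) * ‖x - y‖ :=
    fun j x hx y hy => happ j x (hFt j hx) y (hFt j hy)
  choose y hy hBy using hB hne
  have hrκ' := fun j => hrκ (B j) fun v hv =>
    hder (y j) (hT₀T (hy j)) v (by simpa [hBy] using hv)
  have hpert := fun j : Fin N =>
    exists_near_isometric_perturbation hXW (F := F j) (φ := φ) (f := f₁)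
      ((ContinuousLinearMap.fst ℝ Y W).comp (B j)) ((ContinuousLinearMap.snd ℝ Y W).comp (B j))
      hε0 hε1 (r (B j)).coe_nonneg (hrκ' j).1 (hrκ' j).2.1 (hrκ' j).2.2
      (fun z => by simpa [hBy] using (hT₀P (y j) (hy j)).2.2 z)
      (fun x hx y hy => (norm_fst_le _).trans (happ' j x hx y hy))
      (fun x hx y hy => (norm_snd_le _).trans (happ' j x hx y hy)) ha
  choose u hua hu Q hQ hQu using hpert
  obtain ⟨g, hg, hgu, hgf⟩ := hglue u
    (by rintro j _ ⟨x, hx, rfl⟩ _ ⟨y, hy, rfl⟩; exact hu j x hx y hy) (fun j p _ => hua j p)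
  have hgφ := hg.comp hφ
  refine ⟨g, hg, hgf, ⋃ j : Fin N, F j, iUnion_subset fun j => (hFT₀ j).trans hT₀T,
    MeasurableSet.iUnion fun j => (hFc j).measurableSet, ?_, ?_⟩
  · calc μ (T \ ⋃ j : Fin N, F j) ≤ μ ((T \ T₀) ∪ (T₀ \ ⋃ j : Fin N, F j)) :=
          measure_mono fun x hx => by
            by_cases h : x ∈ T₀
            · exact Or.inr ⟨h, hx.2⟩
            · exact Or.inl ⟨hx.1, h⟩
      _ ≤ _ := (measure_union_le _ _).trans (by rw [hμT₀, zero_add]; exact hFμ)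
  have hpair : ∀ (j : Fin N) i, ∀ x ∈ closure (F j ∩ Q j i), ∀ y ∈ closure (F j ∩ Q j i),
      (1 - ε) * ‖φ x - φ y‖ ≤ ‖g (φ x) - g (φ y)‖ + ε * ‖x - y‖ := by
    intro j i x hx y hy
    have hcl : IsClosed {z : X × X | (1 - ε) * ‖φ z.1 - φ z.2‖ ≤
        ‖g (φ z.1) - g (φ z.2)‖ + ε * ‖z.1 - z.2‖} := by
      have := hφ.continuous
      have := hg.continuous
      exact isClosed_le (by fun_prop) (by fun_prop)
    have hsub : (F j ∩ Q j i) ×ˢ (F j ∩ Q j i) ⊆ {z : X × X | (1 - ε) * ‖φ z.1 - φ z.2‖ ≤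
        ‖g (φ z.1) - g (φ z.2)‖ + ε * ‖z.1 - z.2‖} := fun z hz => by
      have := hQu j i _ hz.1 _ hz.2
      rwa [← hgu j (mem_image_of_mem _ hz.1.1), ← hgu j (mem_image_of_mem _ hz.2.1)] at this
    exact closure_minimal hsub hcl (show (x, y) ∈ _ by rw [closure_prod_eq]; exact ⟨hx, hy⟩)
  have hae : ∀ (j : Fin N) i, ∀ᵐ x ∂μ.restrict (closure (F j ∩ Q j i)),
      ∀ v, (1 - ε) * ‖fderiv ℝ φ x v‖ ≤ ‖fderiv ℝ (g ∘ φ) x v‖ + ε * ‖v‖ := by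
    intro j i
    filter_upwards [ae_fullTangent μ (closure (F j ∩ Q j i)),
      ae_restrict_of_ae hφ.ae_differentiableAt, ae_restrict_of_ae hgφ.ae_differentiableAt,
      ae_restrict_mem isClosed_closure.measurableSet] with x hx h1 h2 hxm v
    have := hx.norm_fderiv_le (c := ε) (h1.hasFDerivAt.const_smul (1 - ε)) h2.hasFDerivAt
      (fun y hy => by
        rw [Pi.smul_apply, Pi.smul_apply, ← smul_sub, norm_smul, Real.norm_of_nonneg hs]
        exact hpair j i y hy x hxm) v
    simpa [norm_smul, Real.norm_of_nonneg hs] using this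
  refine ae_mono (Measure.restrict_mono (?_ : _ ⊆ ⋃ j : Fin N, ⋃ i, closure (F j ∩ Q j i)) le_rfl) ?_
  · refine iUnion_mono fun j x hx => ?_
    obtain ⟨i, hi⟩ := hQ j x
    exact mem_iUnion.2 ⟨i, subset_closure ⟨hx, hi⟩⟩
  · exact (ae_restrict_iUnion_iff _ _).2 fun j => (ae_restrict_iUnion_iff _ _).2 (hae j)

theorem exists_near_energy_lt {X Y W : Type*} [NormedAddCommGroup X] [NormedSpace ℝ X]
    [FiniteDimensional ℝ X] [MeasurableSpace X] [BorelSpace X] {μ : Measure X} [μ.IsAddHaarMeasure]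
    [NormedAddCommGroup Y] [InnerProductSpace ℝ Y] [FiniteDimensional ℝ Y]
    [NormedAddCommGroup W] [InnerProductSpace ℝ W] [FiniteDimensional ℝ W]
    (hXW : Module.finrank ℝ X ≤ Module.finrank ℝ W) {T : Set X} (hT : MeasurableSet T)
    (hμT : μ T ≠ ∞) {φ : X → Y} {Kφ : NNReal} (hφ : LipschitzWith Kφ φ) (hinj : InjOn φ T)
    (hder : ∀ x ∈ T, ∀ v, fderiv ℝ φ x v = 0 → v = 0) {f : Y → W} (hf : LipschitzWith 1 f)
    (v : X) {c δ M : ℝ} (hc : 0 < c) (hδ : 0 < δ) (hM : 0 ≤ M) :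
    ∃ g : Y → W, LipschitzWith 1 g ∧ (∀ p, ‖f p‖ ≤ M → ‖g p - f p‖ ≤ δ) ∧
      ∫ x in T, ‖fderiv ℝ φ x v‖ ^ 2 ∂μ - c < ∫ x in T, ‖fderiv ℝ (g ∘ φ) x v‖ ^ 2 ∂μ := by
  set L : ℝ := Kφ * ‖v‖
  have hL : 0 ≤ L := by positivity
  set J : ℝ := 2 * L * (L + ‖v‖) * (μ T).toReal + L ^ 2 + 1 with hJ
  have hJ0 : 0 < J := by positivity
  set ε : ℝ := min (1 / 2) (min (c / (2 * J)) (δ / (2 * (M + 1)))) with hε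
  have hε0 : 0 < ε := by positivity
  have hε1 : ε < 1 := (min_le_left _ _).trans_lt (by norm_num)
  have hεJ : ε * J < c := by
    have : ε ≤ c / (2 * J) := (min_le_right _ _).trans (min_le_left _ _)
    rw [le_div_iff₀ (by positivity)] at this
    linarith
  have hεM : ε * M ≤ δ / 2 := by
    have : ε ≤ δ / (2 * (M + 1)) := (min_le_right _ _).trans (min_le_right _ _)
    rw [le_div_iff₀ (by positivity)] at this
    linarith
  obtain ⟨g, hg, hgf, T', hT'T, hT', hμT', hae⟩ := exists_near_isometric hXW hT hμT hφ hinj hder hf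
    hε0 hε1 (half_pos hδ) (η := ENNReal.ofReal ε) (by simpa using hε0)
  have hgφ : LipschitzWith Kφ (g ∘ φ) := by simpa using hg.comp hφ
  refine ⟨g, hg, fun p hp => ?_, ?_⟩
  · have h1 : g p - f p = (g p - (1 - ε) • f p) + (-ε) • f p := by module
    rw [h1]
    refine (norm_add_le _ _).trans ?_
    rw [norm_smul, norm_neg, Real.norm_of_nonneg hε0.le]
    have := mul_le_mul_of_nonneg_left hp hε0.le
    linarith [hgf p]
  have hμT'f : μ T' ≠ ∞ := ((measure_mono hT'T).trans_lt hμT.lt_top).ne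
  have hφi := integrableOn_norm_fderiv_sq hφ hμT v
  have hgi := integrableOn_norm_fderiv_sq hgφ hμT v
  have hsplit := integral_inter_add_sdiff (f := fun x => ‖fderiv ℝ φ x v‖ ^ 2) hT' hφi
  rw [inter_eq_right.2 hT'T] at hsplit
  have h1 : ∫ x in T', ‖fderiv ℝ φ x v‖ ^ 2 ∂μ ≤
      ∫ x in T', (‖fderiv ℝ (g ∘ φ) x v‖ ^ 2 + 2 * L * (ε * (L + ‖v‖))) ∂μ := by
    refine integral_mono_ae (hφi.mono_set hT'T)
      ((hgi.mono_set hT'T).add (integrableOn_const hμT'f)) ?_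
    filter_upwards [hae] with x hx
    have a1 := hx v
    have a2 := norm_fderiv_apply_le hφ x v
    have a3 := norm_fderiv_apply_le hgφ x v
    have a4 : ‖fderiv ℝ φ x v‖ ≤ ‖fderiv ℝ (g ∘ φ) x v‖ + ε * (L + ‖v‖) := by nlinarith
    have hb := norm_nonneg (fderiv ℝ (g ∘ φ) x v)
    have ha := norm_nonneg (fderiv ℝ φ x v)
    have hq : 0 ≤ ε * (L + ‖v‖) := by positivity
    nlinarith
  have h2 : ∫ x in T', (‖fderiv ℝ (g ∘ φ) x v‖ ^ 2 + 2 * L * (ε * (L + ‖v‖))) ∂μ ≤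
      ∫ x in T, ‖fderiv ℝ (g ∘ φ) x v‖ ^ 2 ∂μ + (μ T).toReal * (2 * L * (ε * (L + ‖v‖))) := by
    rw [integral_add (hgi.mono_set hT'T) (integrableOn_const hμT'f), setIntegral_const,
      smul_eq_mul]
    refine add_le_add (setIntegral_mono_set hgi (Eventually.of_forall fun x => by positivity)
      hT'T.eventuallyLE) ?_
    gcongr
    exact ENNReal.toReal_mono hμT (measure_mono hT'T)
  have h3 : ∫ x in T \ T', ‖fderiv ℝ φ x v‖ ^ 2 ∂μ ≤ L ^ 2 * ε := by
    have hfin : μ (T \ T') < ∞ := (measure_mono sdiff_subset).trans_lt hμT.lt_top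
    calc ∫ x in T \ T', ‖fderiv ℝ φ x v‖ ^ 2 ∂μ ≤ ∫ x in T \ T', L ^ 2 ∂μ :=
          integral_mono (hφi.mono_set sdiff_subset) (integrableOn_const hfin.ne) fun x => by
            have := norm_fderiv_apply_le hφ x v
            dsimp only
            gcongr
      _ = (μ (T \ T')).toReal * L ^ 2 := by rw [setIntegral_const, smul_eq_mul]; rfl
      _ ≤ L ^ 2 * ε := by
        rw [mul_comm]
        gcongr
        exact ENNReal.toReal_le_of_le_ofReal hε0.le hμT'
  have h4 : ∫ x in T, ‖fderiv ℝ φ x v‖ ^ 2 ∂μ ≤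
      ∫ x in T, ‖fderiv ℝ (g ∘ φ) x v‖ ^ 2 ∂μ + ε * J := by
    rw [hJ]
    nlinarith
  linarith

theorem setIntegral_norm_fderiv_sq_congr {X V : Type*} [NormedAddCommGroup X] [NormedSpace ℝ X]
    [FiniteDimensional ℝ X] [MeasurableSpace X] [BorelSpace X] {μ : Measure X} [μ.IsAddHaarMeasure]
    [NormedAddCommGroup V] [NormedSpace ℝ V] [FiniteDimensional ℝ V] {T : Set X}
    (hT : MeasurableSet T) {h₁ h₂ : X → V} {C : NNReal} (hh₁ : LipschitzWith C h₁)
    (hh₂ : LipschitzWith C h₂) (h : EqOn h₁ h₂ T) (v : X) :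
    ∫ x in T, ‖fderiv ℝ h₁ x v‖ ^ 2 ∂μ = ∫ x in T, ‖fderiv ℝ h₂ x v‖ ^ 2 ∂μ := by
  refine integral_congr_ae ?_
  filter_upwards [ae_fullTangent μ T, ae_restrict_mem hT,
    ae_restrict_of_ae hh₁.ae_differentiableAt, ae_restrict_of_ae hh₂.ae_differentiableAt]
    with x hx hxT d1 d2
  have e1 := hx.norm_fderiv_le (c := 0) d1.hasFDerivAt d2.hasFDerivAt
    (fun y hy => by rw [h hy, h hxT]; simp) v
  have e2 := hx.norm_fderiv_le (c := 0) d2.hasFDerivAt d1.hasFDerivAt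
    (fun y hy => by rw [h hy, h hxT]; simp) v
  simp only [zero_mul, add_zero] at e1 e2
  rw [le_antisymm e1 e2]

theorem ae_forall_norm_fderiv_eq {X V W : Type*} [NormedAddCommGroup X] [NormedSpace ℝ X]
    [FiniteDimensional ℝ X] [MeasurableSpace X] [BorelSpace X] {μ : Measure X} [μ.IsAddHaarMeasure]
    [NormedAddCommGroup V] [NormedSpace ℝ V] [FiniteDimensional ℝ V]
    [NormedAddCommGroup W] [NormedSpace ℝ W] [FiniteDimensional ℝ W] {T : Set X}
    (hT : MeasurableSet T) (hμT : μ T ≠ ∞) {φ : X → V} {h : X → W} {C : NNReal}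
    (hφ : LipschitzWith C φ) (hh : LipschitzWith C h)
    (hle : ∀ x ∈ T, ∀ y ∈ T, ‖h x - h y‖ ≤ ‖φ x - φ y‖) {S : Set X} (hS : S.Countable)
    (hSd : Dense S) (hint : ∀ v ∈ S,
      ∫ x in T, ‖fderiv ℝ φ x v‖ ^ 2 ∂μ ≤ ∫ x in T, ‖fderiv ℝ h x v‖ ^ 2 ∂μ) :
    ∀ᵐ x ∂μ.restrict T, ∀ v, ‖fderiv ℝ h x v‖ = ‖fderiv ℝ φ x v‖ := by
  have hle' : ∀ᵐ x ∂μ.restrict T, ∀ v, ‖fderiv ℝ h x v‖ ≤ ‖fderiv ℝ φ x v‖ := by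
    filter_upwards [ae_fullTangent μ T, ae_restrict_mem hT,
      ae_restrict_of_ae hh.ae_differentiableAt, ae_restrict_of_ae hφ.ae_differentiableAt]
      with x hx hxT d1 d2 v
    simpa using hx.norm_fderiv_le (c := 0) d1.hasFDerivAt d2.hasFDerivAt
      (fun y hy => by simpa using hle y hy x hxT) v
  have heq : ∀ᵐ x ∂μ.restrict T, ∀ v ∈ S, ‖fderiv ℝ h x v‖ = ‖fderiv ℝ φ x v‖ := by
    rw [ae_ball_iff hS]
    intro v hv
    have i1 := integrableOn_norm_fderiv_sq hφ hμT v
    have i2 := integrableOn_norm_fderiv_sq hh hμT v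
    have hnn : 0 ≤ᵐ[μ.restrict T] fun x => ‖fderiv ℝ φ x v‖ ^ 2 - ‖fderiv ℝ h x v‖ ^ 2 := by
      filter_upwards [hle'] with x hx
      have := hx v
      simp only [Pi.zero_apply, sub_nonneg]
      gcongr
    have h0 : ∫ x in T, (‖fderiv ℝ φ x v‖ ^ 2 - ‖fderiv ℝ h x v‖ ^ 2) ∂μ = 0 := by
      refine le_antisymm ?_ (integral_nonneg_of_ae hnn)
      rw [integral_sub i1 i2]
      linarith [hint v hv]
    filter_upwards [(integral_eq_zero_iff_of_nonneg_ae hnn (i1.sub i2)).1 h0] with x hx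
    simp only [Pi.zero_apply, sub_eq_zero] at hx
    exact ((sq_eq_sq₀ (norm_nonneg _) (norm_nonneg _)).1 hx).symm
  filter_upwards [heq] with x hx v
  have h1 : Continuous fun v => ‖fderiv ℝ h x v‖ := by fun_prop
  have h2 : Continuous fun v => ‖fderiv ℝ φ x v‖ := by fun_prop
  exact congrFun (Continuous.ext_on hSd h1 h2 hx) v

theorem LipE.exists_extension {m k : ℕ} {D : Set (Euc k)} (f : LipE 1 (↥D) m) :
    ∃ g : Euc k → Euc m, LipschitzWith 1 g ∧ ∀ x : ↥D, g x = f.1 x := by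
  classical
  have hf : LipschitzOnWith 1 (fun x => if h : x ∈ D then f.1 ⟨x, h⟩ else 0) D := by
    intro x hx y hy
    simpa [hx, hy] using f.2 ⟨x, hx⟩ ⟨y, hy⟩
  obtain ⟨g, hg, hgf⟩ := hf.exists_extend_one
  refine ⟨g, hg, fun x => ?_⟩
  have := hgf x.2
  simpa using this.symm

theorem eventually_residual_norm_fderiv_eq {n m k : ℕ} (hnm : n ≤ m) {μ : Measure (Euc n)}
    [μ.IsAddHaarMeasure] {D : Set (Euc k)} {T : Set (Euc n)} (hT : MeasurableSet T)
    (hμT : μ T ≠ ∞) {φ : Euc n → Euc k} {K : NNReal} (hφ : LipschitzWith K φ) (hinj : InjOn φ T)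
    (hder : ∀ x ∈ T, ∀ v, fderiv ℝ φ x v = 0 → v = 0) (hTD : MapsTo φ T D) :
    ∀ᶠ f : LipE 1 (↥D) m in residual (LipE 1 (↥D) m), ∀ g : Euc k → Euc m, LipschitzWith 1 g →
      (∀ x : ↥D, g x = f.1 x) →
      ∀ᵐ x ∂μ.restrict T, ∀ v, ‖fderiv ℝ (g ∘ φ) x v‖ = ‖fderiv ℝ φ x v‖ := by
  set I : Euc n → ℝ := fun v => ∫ x in T, ‖fderiv ℝ φ x v‖ ^ 2 ∂μ with hI
  set U : Euc n → ℕ → Set (LipE 1 (↥D) m) := fun v j => {f | ∃ g : Euc k → Euc m,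
    LipschitzWith 1 g ∧ (∀ x : ↥D, g x = f.1 x) ∧
    I v - 1 / ((j : ℝ) + 1) < ∫ x in T, ‖fderiv ℝ (g ∘ φ) x v‖ ^ 2 ∂μ} with hU
  have hcomp : ∀ g : Euc k → Euc m, LipschitzWith 1 g → LipschitzWith K (g ∘ φ) :=
    fun g hg => by simpa using hg.comp hφ
  have hopen : ∀ v j, IsOpen (U v j) := by
    intro v j
    rw [Metric.isOpen_iff]
    rintro f ⟨g, hg, hgf, hlt⟩
    obtain ⟨ρ, hρ, H⟩ := lowerSemicontinuous_energy hT hμT (hcomp g hg) v hlt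
    refine ⟨ρ, hρ, fun f' hf' => ?_⟩
    obtain ⟨g', hg', hgf'⟩ := f'.exists_extension
    refine ⟨g', hg', hgf', H _ (hcomp g' hg') fun x hx => ?_⟩
    have e1 := hgf' ⟨φ x, hTD hx⟩
    have e2 := hgf ⟨φ x, hTD hx⟩
    simp only at e1 e2
    rw [Function.comp_apply, Function.comp_apply, e1, e2, ← dist_eq_norm]
    exact (BoundedContinuousFunction.dist_coe_le_dist _).trans (mem_ball.1 hf').le
  have hdense : ∀ v j, Dense (U v j) := by
    intro v j
    rw [Metric.dense_iff]
    intro f r hr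
    obtain ⟨f₁, hf₁, hff₁⟩ := f.exists_extension
    obtain ⟨g, hg, hgf, hlt⟩ := exists_near_energy_lt (by simpa using hnm) hT hμT hφ hinj hder hf₁ v
      (c := 1 / ((j : ℝ) + 1)) (by positivity) (half_pos hr) (norm_nonneg f.1)
    have hgD : ∀ x : ↥D, ‖g x - f.1 x‖ ≤ r / 2 := fun x => by
      have := hgf x (by rw [hff₁]; exact f.1.norm_coe_le_norm x)
      rwa [hff₁] at this
    have hgL : LipschitzWith 1 fun x : ↥D => g x :=
      LipschitzWith.of_dist_le_mul fun x y => hg.dist_le_mul x y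
    refine ⟨⟨BoundedContinuousFunction.ofNormedAddCommGroup (fun x : ↥D => g x) hgL.continuous
      (‖f.1‖ + r / 2) fun x => ?_, hgL⟩, mem_ball.2 ?_, g, hg, fun x => rfl, hlt⟩
    · have h1 : g x = f.1 x + (g x - f.1 x) := by abel
      rw [h1]
      exact (norm_add_le _ _).trans (add_le_add (f.1.norm_coe_le_norm x) (hgD x))
    · refine lt_of_le_of_lt ?_ (half_lt_self hr)
      rw [Subtype.dist_eq, BoundedContinuousFunction.dist_le (half_pos hr).le]
      intro x
      rw [dist_eq_norm]
      exact hgD x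
  obtain ⟨S, hS, hSd⟩ := TopologicalSpace.exists_countable_dense (Euc n)
  have hres : ∀ᶠ f : LipE 1 (↥D) m in residual (LipE 1 (↥D) m), ∀ v ∈ S, ∀ j, f ∈ U v j :=
    (eventually_countable_ball hS).2 fun v _ => eventually_countable_forall.2 fun j =>
      residual_of_dense_open (hopen v j) (hdense v j)
  filter_upwards [hres] with f hf g hg hgf
  refine ae_forall_norm_fderiv_eq hT hμT hφ (hcomp g hg)
    (fun x _ y _ => by simpa [dist_eq_norm] using hg.dist_le_mul (φ x) (φ y)) hS hSd fun v hv => ?_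
  refine le_of_forall_pos_lt_add fun c hc => ?_
  obtain ⟨j, hj⟩ := exists_nat_one_div_lt hc
  obtain ⟨g', hg', hgf', hlt⟩ := hf v hv j
  have heq := setIntegral_norm_fderiv_sq_congr (μ := μ) hT (hcomp g' hg') (hcomp g hg)
    (fun x hx => (hgf' ⟨φ x, hTD hx⟩).trans (hgf ⟨φ x, hTD hx⟩).symm) v
  rw [heq] at hlt
  linarith

theorem hausdorffMeasure_image_le_lintegral_encard_fiber {X Y W : Type*} [NormedAddCommGroup X]
    [InnerProductSpace ℝ X] [FiniteDimensional ℝ X] [MeasurableSpace X] [BorelSpace X]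
    [NormedAddCommGroup Y] [NormedSpace ℝ Y] [FiniteDimensional ℝ Y] [MeasurableSpace Y]
    [BorelSpace Y] [NormedAddCommGroup W] [NormedSpace ℝ W] [FiniteDimensional ℝ W]
    [MeasurableSpace W] [BorelSpace W] {d : ℝ} (hd : 0 ≤ d) {T : Set X} (hT : MeasurableSet T)
    {φ : X → Y} {K : NNReal} (hφ : LipschitzWith K φ) (hinj : InjOn φ T)
    (hder : ∀ x ∈ T, ∀ v, fderiv ℝ φ x v = 0 → v = 0) {g : Y → W} (hg : LipschitzWith 1 g)
    (hiso : ∀ᵐ x ∂(μH[d] : Measure X).restrict T,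
      ∀ v, ‖fderiv ℝ (g ∘ φ) x v‖ = ‖fderiv ℝ φ x v‖)
    (hdiff : ∀ᵐ x ∂(μH[d] : Measure X).restrict T,
      DifferentiableAt ℝ φ x ∧ DifferentiableAt ℝ (g ∘ φ) x) :
    μH[d] (φ '' T) ≤ ∫⁻ y, (({p | p ∈ φ '' T ∧ g p = y}.encard : ℝ≥0∞)) ∂(μH[d] : Measure W) := by
  set I := ∫⁻ y, (({p | p ∈ φ '' T ∧ g p = y}.encard : ℝ≥0∞)) ∂(μH[d] : Measure W)
  obtain ⟨T₀, hT₀T, hT₀, hμT₀, hT₀P⟩ := exists_measurableSet_subset_forall_of_ae hT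
    (hiso.and hdiff)
  have hnull : μH[d] (φ '' (T \ T₀)) = 0 := by
    have := hφ.hausdorffMeasure_image_le hd (T \ T₀)
    rw [hμT₀, mul_zero] at this
    exact le_antisymm this zero_le
  have hmain : ∀ L : NNReal, 1 < L → μH[d] (φ '' T₀) ≤ (L : ℝ≥0∞) ^ d * I := by
    intro L hL
    rcases T₀.eq_empty_or_nonempty with rfl | hne
    · simp
    have hL' : (1 : ℝ) < L := hL
    have hLinv : (L : ℝ)⁻¹ < 1 := inv_lt_one_of_one_lt₀ hL'
    have hLinv0 : 0 < (L : ℝ)⁻¹ := by positivity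
    set δ : ℝ := 1 - (L : ℝ)⁻¹ with hδ
    have hδ0 : 0 < δ := by linarith
    have hδL : (1 - δ) * L = 1 := by
      rw [hδ]
      field_simp
      ring
    have hr : ∀ B : X →L[ℝ] Y × W, ∃ (r : NNReal) (κ : ℝ), r ≠ 0 ∧
        ((∀ v, (B v).1 = 0 → v = 0) → (∀ z, κ * ‖z‖ ≤ ‖(B z).1‖) ∧ 3 * (r : ℝ) = δ * κ) := by
      intro B
      by_cases hB : ∀ v, (B v).1 = 0 → v = 0
      · obtain ⟨κ, hκ, h⟩ := ((ContinuousLinearMap.fst ℝ Y W).comp B).exists_pos_mul_norm_le hB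
        have h0 : 0 < δ * κ / 3 := by positivity
        refine ⟨Real.toNNReal (δ * κ / 3), κ, by simpa using h0, fun _ => ⟨h, ?_⟩⟩
        rw [Real.coe_toNNReal _ h0.le]
        ring
      · exact ⟨1, 0, one_ne_zero, fun h => absurd h hB⟩
    choose r κ hr0 hrκ using hr
    obtain ⟨t, B, htd, htm, hcov, happ, hB⟩ :=
      exists_partition_approximatesLinearOn_of_hasFDerivWithinAt (fun x => (φ x, g (φ x))) T₀
        (fun x => (fderiv ℝ φ x).prod (fderiv ℝ (g ∘ φ) x))
        (fun x hx => ((hT₀P x hx).2.1.hasFDerivAt.prodMk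
          (hT₀P x hx).2.2.hasFDerivAt).hasFDerivWithinAt) r hr0
    choose z hz hBz using hB hne
    have hexp : ∀ j, ∀ x ∈ T₀ ∩ t j, ∀ y ∈ T₀ ∩ t j,
        dist (φ x) (φ y) ≤ L * dist (g (φ x)) (g (φ y)) := by
      intro j x hx y hy
      have h1 := happ j x hx y hy
      obtain ⟨h2, h3⟩ := hrκ (B j) fun v hv => hder (z j) (hT₀T (hz j)) v (by simpa [hBz] using hv)
      have h4 : ‖(B j (x - y)).2‖ = ‖(B j (x - y)).1‖ := by
        simpa [hBz] using (hT₀P _ (hz j)).1 (x - y)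
      have h5 := (norm_fst_le _).trans h1
      have h6 := (norm_snd_le _).trans h1
      simp only [Prod.fst_sub, Prod.snd_sub] at h5 h6
      have h7 := norm_sub_norm_le (B j (x - y)).1 (φ x - φ y)
      have h8 := norm_sub_norm_le (φ x - φ y) (B j (x - y)).1
      have h9 := norm_sub_norm_le (B j (x - y)).2 (g (φ x) - g (φ y))
      rw [norm_sub_rev (B j (x - y)).1] at h7
      rw [norm_sub_rev (B j (x - y)).2] at h9
      rw [dist_eq_norm, dist_eq_norm]
      have h10 := h2 (x - y)
      have h11 : 2 * (r (B j) * ‖x - y‖) ≤ δ * ‖φ x - φ y‖ := by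
        have e1 : 3 * (r (B j) * ‖x - y‖) = δ * (κ (B j) * ‖x - y‖) := by
          rw [← mul_assoc, h3, mul_assoc]
        have e2 : κ (B j) * ‖x - y‖ - r (B j) * ‖x - y‖ ≤ ‖φ x - φ y‖ := by linarith
        have e3 : 0 ≤ (r (B j) : ℝ) * ‖x - y‖ := by positivity
        nlinarith
      have h12 : (1 - δ) * ‖φ x - φ y‖ ≤ ‖g (φ x) - g (φ y)‖ := by linarith
      calc ‖φ x - φ y‖ = L * ((1 - δ) * ‖φ x - φ y‖) := by
            rw [← mul_assoc, mul_comm (L : ℝ), hδL, one_mul]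
        _ ≤ _ := by gcongr
    have hmeas : ∀ j, MeasurableSet (g '' (φ '' (T₀ ∩ t j))) := by
      intro j
      rw [← image_comp]
      refine (hT₀.inter (htm j)).image_of_continuousOn_injOn
        (hg.continuous.comp hφ.continuous).continuousOn fun x hx y hy hxy => ?_
      have := hexp j x hx y hy
      rw [show g (φ x) = g (φ y) from hxy, dist_self, mul_zero] at this
      exact hinj (hT₀T hx.1) (hT₀T hy.1) (dist_le_zero.1 this)
    have hdisj : Pairwise (Function.onFun Disjoint fun j => φ '' (T₀ ∩ t j)) := by
      intro i j hij
      refine disjoint_left.2 ?_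
      rintro _ ⟨x, hx, rfl⟩ ⟨y, hy, hyx⟩
      have := hinj (hT₀T hy.1) (hT₀T hx.1) hyx
      exact disjoint_left.1 (htd hij) hx.2 (this ▸ hy.2)
    calc μH[d] (φ '' T₀) ≤ μH[d] (⋃ j, φ '' (T₀ ∩ t j)) := by
          refine measure_mono ?_
          rw [← image_iUnion, ← inter_iUnion, inter_eq_left.2 hcov]
      _ ≤ ∑' j, μH[d] (φ '' (T₀ ∩ t j)) := measure_iUnion_le _
      _ ≤ ∑' j, (L : ℝ≥0∞) ^ d * ∫⁻ y, (({p | p ∈ φ '' (T₀ ∩ t j) ∧ g p = y}.encard : ℝ≥0∞))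
            ∂(μH[d] : Measure W) := by
          refine ENNReal.tsum_le_tsum fun j => ?_
          refine (hausdorffMeasure_image_le_of_dist_le (β := g ∘ φ) hd (hexp j)).trans ?_
          gcongr
          rw [image_comp]
          exact measure_image_le_lintegral_encard_fiber (hmeas j)
      _ = (L : ℝ≥0∞) ^ d * ∑' j, ∫⁻ y, (({p | p ∈ φ '' (T₀ ∩ t j) ∧ g p = y}.encard : ℝ≥0∞))
            ∂(μH[d] : Measure W) := ENNReal.tsum_mul_left
      _ ≤ (L : ℝ≥0∞) ^ d * I := by
          gcongr
          exact tsum_lintegral_encard_fiber_le hdisj fun j =>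
            image_mono (inter_subset_left.trans hT₀T)
  have hlim : Tendsto (fun j : ℕ => ((1 + 1 / ((j : NNReal) + 1) : NNReal) : ℝ≥0∞) ^ d * I) atTop
      (𝓝 ((1 : ℝ≥0∞) ^ d * I)) := by
    refine ENNReal.Tendsto.mul_const ((ENNReal.continuous_rpow_const.tendsto _).comp ?_)
      (Or.inl (by simp))
    have : Tendsto (fun j : ℕ => 1 + 1 / ((j : NNReal) + 1)) atTop (𝓝 (1 + 0)) :=
      tendsto_one_div_add_atTop_nhds_zero_nat.const_add 1
    rw [add_zero] at this
    exact ENNReal.tendsto_coe.2 this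
  calc μH[d] (φ '' T) ≤ μH[d] (φ '' T₀ ∪ φ '' (T \ T₀)) := by
        rw [← image_union, union_sdiff_cancel hT₀T]
    _ ≤ μH[d] (φ '' T₀) + μH[d] (φ '' (T \ T₀)) := measure_union_le _ _
    _ = μH[d] (φ '' T₀) := by rw [hnull, add_zero]
    _ ≤ (1 : ℝ≥0∞) ^ d * I := ge_of_tendsto' hlim fun j => hmain _ (by simp)
    _ = I := by simp

instance isAddHaarMeasure_hausdorffMeasure_euc (n : ℕ) :
    (μH[n] : Measure (Euc n)).IsAddHaarMeasure := by
  have : (μH[Module.finrank ℝ (Euc n)] : Measure (Euc n)).IsAddHaarMeasure := inferInstance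
  rwa [finrank_euclideanSpace_fin] at this

theorem LipschitzWith.hausdorffMeasure_image_compl_injective_eq_zero {n k : ℕ}
    {φ : Euc n → Euc k} {K : NNReal} (hφ : LipschitzWith K φ) :
    μH[n] (φ '' ({x | DifferentiableAt ℝ φ x} ∩
      fderiv ℝ φ ⁻¹' {A | Function.Injective A})ᶜ) = 0 := by
  have h1 : μH[n] (φ '' {x | ¬ DifferentiableAt ℝ φ x}) = 0 := by
    have h := hφ.hausdorffMeasure_image_le (Nat.cast_nonneg n) {x | ¬ DifferentiableAt ℝ φ x}
    rw [show μH[n] {x | ¬ DifferentiableAt ℝ φ x} = 0 from ae_iff.1 hφ.ae_differentiableAt,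
      mul_zero] at h
    exact le_antisymm h zero_le
  have h2 : μH[n] (φ '' {x | DifferentiableAt ℝ φ x ∧ ∃ v, v ≠ 0 ∧ fderiv ℝ φ x v = 0}) = 0 := by
    have h := hausdorffMeasure_image_eq_zero_of_ker (φ := φ) (φ' := fderiv ℝ φ)
      (S := {x | DifferentiableAt ℝ φ x ∧ ∃ v, v ≠ 0 ∧ fderiv ℝ φ x v = 0})
      (fun x hx => hx.1.hasFDerivAt.hasFDerivWithinAt) (fun x hx => hx.2)
    rwa [finrank_euclideanSpace_fin] at h
  refine measure_mono_null ?_ (measure_union_null h1 h2)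
  rw [← image_union]
  refine image_mono fun x hx => ?_
  by_cases hd : DifferentiableAt ℝ φ x
  · refine Or.inr ⟨hd, ?_⟩
    by_contra! hc
    exact hx ⟨hd, (injective_iff_map_eq_zero _).2 fun v hv => by_contra fun h => hc v h hv⟩
  · exact Or.inl hd

theorem exists_injOn_pieces {n k : ℕ} {φ : Euc n → Euc k} {K : NNReal} (hφ : LipschitzWith K φ)
    {E : Set (Euc k)} (hE : MeasurableSet E) :
    ∃ T : ℕ × ℕ → Set (Euc n), (∀ j, MeasurableSet (T j)) ∧ (∀ j, μH[n] (T j) ≠ ∞) ∧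
      (∀ j, InjOn φ (T j)) ∧ (∀ j, ∀ x ∈ T j, ∀ v, fderiv ℝ φ x v = 0 → v = 0) ∧
      (∀ j, MapsTo φ (T j) E) ∧ μH[n] (φ '' (φ ⁻¹' E \ ⋃ j, T j)) = 0 := by
  set S : Set (Euc n) := {x | DifferentiableAt ℝ φ x} ∩
    fderiv ℝ φ ⁻¹' {A | Function.Injective A} with hS
  have hSm : MeasurableSet S := (measurableSet_of_differentiableAt ℝ φ).inter
    (measurable_fderiv ℝ φ ContinuousLinearMap.isOpen_injective.measurableSet)
  have hSder : ∀ x ∈ S, ∀ v, fderiv ℝ φ x v = 0 → v = 0 := fun x hx v hv =>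
    hx.2 (hv.trans (map_zero _).symm)
  have hnull : μH[n] (φ '' Sᶜ) = 0 := hφ.hausdorffMeasure_image_compl_injective_eq_zero
  have hr : ∀ A : Euc n →L[ℝ] Euc k, ∃ (r : NNReal) (κ : ℝ), r ≠ 0 ∧
      ((∀ v, A v = 0 → v = 0) → (∀ z, κ * ‖z‖ ≤ ‖A z‖) ∧ (r : ℝ) < κ) := by
    intro A
    by_cases hA : ∀ v, A v = 0 → v = 0
    · obtain ⟨κ, hκ, h⟩ := A.exists_pos_mul_norm_le hA
      refine ⟨Real.toNNReal (κ / 2), κ, by simpa using hκ, fun _ => ⟨h, ?_⟩⟩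
      rw [Real.coe_toNNReal _ (half_pos hκ).le]
      exact half_lt_self hκ
    · exact ⟨1, 0, one_ne_zero, fun h => absurd h hA⟩
  choose r κ hr0 hrκ using hr
  obtain ⟨t, A, -, htm, hcov, happ, hA⟩ :=
    exists_partition_approximatesLinearOn_of_hasFDerivWithinAt φ S (fderiv ℝ φ)
      (fun x hx => hx.1.hasFDerivAt.hasFDerivWithinAt) r hr0
  have hinj : ∀ j, InjOn φ (S ∩ t j) := by
    intro j x hx y hy hxy
    obtain ⟨z, hz, hAz⟩ := hA ⟨x, hx.1⟩ j
    obtain ⟨h1, h2⟩ := hrκ (A j) fun v hv => hSder z hz v (by rwa [← hAz])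
    have h3 := happ j x hx y hy
    rw [hxy, sub_self, zero_sub, norm_neg] at h3
    have h4 := (h1 (x - y)).trans h3
    by_contra hne
    have := norm_pos_iff.2 (sub_ne_zero.2 hne)
    nlinarith
  have hfin : ∀ j : ℕ × ℕ, μH[n] (S ∩ t j.1 ∩ (φ ⁻¹' E ∩ closedBall 0 (j.2 : ℝ))) ≠ ∞ := fun j =>
    ((measure_mono (inter_subset_right.trans inter_subset_right)).trans_lt
      measure_closedBall_lt_top).ne
  refine ⟨fun j => S ∩ t j.1 ∩ (φ ⁻¹' E ∩ closedBall 0 j.2), fun j => (hSm.inter (htm _)).inter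
    ((hφ.continuous.measurable hE).inter measurableSet_closedBall), hfin,
    fun j => (hinj j.1).mono inter_subset_left, fun j x hx => hSder x hx.1.1,
    fun j x hx => hx.2.1, ?_⟩
  refine measure_mono_null (image_mono ?_) hnull
  rintro x ⟨hxE, hxT⟩
  rw [mem_compl_iff]
  intro hxS
  obtain ⟨j, hj⟩ := mem_iUnion.1 (hcov hxS)
  obtain ⟨b, hb⟩ := exists_nat_ge ‖x‖
  exact hxT (mem_iUnion.2 ⟨(j, b), ⟨hxS, hj⟩, hxE, by simpa using hb⟩)

theorem IsRectifiable.exists_charts {n k : ℕ} {E : Set (Euc k)} (hE : IsRectifiable n E) :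
    ∃ (T : ℕ → Set (Euc n)) (φ : ℕ → Euc n → Euc k) (K : ℕ → NNReal),
      (∀ i, MeasurableSet (T i)) ∧ (∀ i, μH[n] (T i) ≠ ∞) ∧ (∀ i, LipschitzWith (K i) (φ i)) ∧
      (∀ i, InjOn (φ i) (T i)) ∧ (∀ i, ∀ x ∈ T i, ∀ v, fderiv ℝ (φ i) x v = 0 → v = 0) ∧
      (∀ i, MapsTo (φ i) (T i) E) ∧
      Pairwise (Function.onFun Disjoint fun i => φ i '' T i) ∧
      μH[n] (E \ ⋃ i, φ i '' T i) = 0 := by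
  obtain ⟨hEm, F, f, K, hf, hcov⟩ := hE
  obtain ⟨E', hE'E, hE', hEE'⟩ := hEm.exists_measurable_subset_ae_eq
  have hdiff : μH[n] (E \ E') = 0 := (ae_le_set.1 hEE'.symm.le)
  choose φ hφ hφf using fun i => (hf i).extend_finite_dimension
  choose T hTm hTμ hTinj hTder hTE hTnull using fun i => exists_injOn_pieces (hφ i) hE'
  set e : ℕ ≃ ℕ × ℕ × ℕ := (Denumerable.eqv _).symm
  set A : ℕ → Set (Euc k) := fun l => φ (e l).1 '' T (e l).1 (e l).2 with hA
  have hAm : ∀ l, MeasurableSet (A l) := fun l => (hTm _ _).image_of_continuousOn_injOn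
    (hφ _).continuous.continuousOn (hTinj _ _)
  have himg : ∀ l, φ (e l).1 '' (T (e l).1 (e l).2 ∩ φ (e l).1 ⁻¹' disjointed A l) =
      disjointed A l := fun l => by
    rw [image_inter_preimage]
    exact inter_eq_right.2 (disjointed_subset A l)
  refine ⟨fun l => T (e l).1 (e l).2 ∩ φ (e l).1 ⁻¹' disjointed A l, fun l => φ (e l).1, _,
    fun l => (hTm _ _).inter ((hφ _).continuous.measurable (MeasurableSet.disjointed hAm l)),
    fun l => ((measure_mono inter_subset_left).trans_lt (hTμ _ _).lt_top).ne, fun l => hφ _,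
    fun l => (hTinj _ _).mono inter_subset_left, fun l x hx => hTder _ _ x hx.1,
    fun l x hx => hE'E (hTE _ _ hx.1), ?_, ?_⟩
  · simp only [himg]
    exact disjoint_disjointed A
  · simp only [himg]
    rw [iUnion_disjointed]
    refine measure_mono_null (fun p hp => ?_) (measure_union_null (measure_union_null hdiff hcov)
      (measure_iUnion_null hTnull))
    by_cases hpE' : p ∈ E'
    swap
    · exact Or.inl (Or.inl ⟨hp.1, hpE'⟩)
    by_cases hpF : p ∈ ⋃ i, f i '' F i
    swap
    · exact Or.inl (Or.inr ⟨hp.1, hpF⟩)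
    obtain ⟨i, x, hx, rfl⟩ := mem_iUnion.1 hpF
    have hxi : f i x = φ i x := hφf i hx
    refine Or.inr (mem_iUnion.2 ⟨i, x, ⟨by rwa [mem_preimage, ← hxi], fun hxT => hp.2 ?_⟩, hxi.symm⟩)
    obtain ⟨j, hj⟩ := mem_iUnion.1 hxT
    exact mem_iUnion.2 ⟨e.symm (i, j), x, by simpa using hj, by simp [hxi]⟩

/-- For `n ≤ m`, `n ≤ k`, an `n`-rectifiable set `E ⊆ ℝ^k` and any `D` with
`E ⊆ D ⊆ ℝ^k`, the set of `f ∈ Lip_1(D, ℝ^m)` whose multiplicity integral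
`∫ #(E ∩ f⁻¹(y)) dH^n(y)` equals `H^n(E)` is residual in `Lip_1(D, ℝ^m)`. -/
theorem stmt0 (n m k : ℕ) (hnm : n ≤ m) (hnk : n ≤ k)
    (E D : Set (Euc k)) (hED : E ⊆ D) (hE : IsRectifiable n E) :
    {f : LipE 1 (↥D) m |
        ∫⁻ y, (({x : ↥D | (x : Euc k) ∈ E ∧ f.1 x = y}.encard : ℝ≥0∞))
            ∂(μH[n] : Measure (Euc m)) = μH[n] E}
      ∈ residual (LipE 1 (↥D) m) := by
  obtain ⟨T, φ, K, hTm, hTμ, hφ, hinj, hder, hTE, hdisj, hcov⟩ := hE.exists_charts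
  have hres := eventually_countable_forall.2 fun i =>
    eventually_residual_norm_fderiv_eq (D := D) hnm (hTm i) (hTμ i) (hφ i) (hinj i) (hder i)
      ((hTE i).mono_right hED)
  filter_upwards [hres] with f hf
  obtain ⟨g, hg, hgf⟩ := f.exists_extension
  have hfib : ∀ y, {x : ↥D | (x : Euc k) ∈ E ∧ f.1 x = y}.encard =
      {p | p ∈ E ∧ g p = y}.encard := by
    intro y
    rw [← Subtype.val_injective.encard_image]
    congr 1
    ext p
    simp only [mem_image, mem_ofPred_eq, ← hgf]
    constructor
    · rintro ⟨x, hx, rfl⟩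
      exact hx
    · exact fun hp => ⟨⟨p, hED hp.1⟩, hp, rfl⟩
  simp only [hfib]
  refine le_antisymm (lintegral_encard_fiber_le hg (Nat.cast_nonneg n) E) ?_
  calc μH[n] E ≤ μH[n] ((E \ ⋃ i, φ i '' T i) ∪ ⋃ i, φ i '' T i) := by
        rw [sdiff_union_self]
        exact measure_mono subset_union_left
    _ ≤ μH[n] (⋃ i, φ i '' T i) := (measure_union_le _ _).trans (by rw [hcov, zero_add])
    _ ≤ ∑' i, μH[n] (φ i '' T i) := measure_iUnion_le _
    _ ≤ ∑' i, ∫⁻ y, (({p | p ∈ φ i '' T i ∧ g p = y}.encard : ℝ≥0∞))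
          ∂(μH[n] : Measure (Euc m)) := by
        refine ENNReal.tsum_le_tsum fun i => ?_
        refine hausdorffMeasure_image_le_lintegral_encard_fiber (Nat.cast_nonneg n) (hTm i) (hφ i)
          (hinj i) (hder i) hg (hf i g hg hgf) (ae_restrict_of_ae ?_)
        filter_upwards [(hφ i).ae_differentiableAt, (hg.comp (hφ i)).ae_differentiableAt]
          with x h1 h2 using ⟨h1, h2⟩
    _ ≤ ∫⁻ y, (({p | p ∈ E ∧ g p = y}.encard : ℝ≥0∞)) ∂(μH[n] : Measure (Euc m)) :=
        tsum_lintegral_encard_fiber_le hdisj fun i => (hTE i).image_subset
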